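/- arXiv:2204.03587 — 4 statements merged into one kernel-verified Lean document; each statement's English description precedes it below -/
import Mathlib

section
/- Let M be a bounded open subset of ℝ² with finite Lebesgue measure λ, and let ω₀, ω ∈ L^∞(M). Then the following are equivalent: (a) there exists a bistochastic kernel K on M with ω = Kω₀ almost everywhere; (b) ∫_M ω dλ = ∫_M ω₀ dλ and for every c ∈ ℝ one has ∫_M (ω − c)₊ dλ ≤ ∫_M (ω₀ − c)₊ dλ, where (t)₊ := max(t,0). -/
open MeasureTheory ProbabilityTheory

/-- A bistochastic kernel on a measure space `(X, μ)`: a Markov kernel `x ↦ κ x`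
such that `∫ κ x A dμ(x) = μ A` for every measurable `A`. -/
def IsBistochastic {X : Type*} [MeasurableSpace X] (μ : Measure X)
    (κ : Kernel X X) : Prop :=
  IsMarkovKernel κ ∧ ∀ A : Set X, MeasurableSet A → ∫⁻ x, κ x A ∂μ = μ A

/-- `(Kω)(x) := ∫ ω(y) dκ_x(y)`. -/
noncomputable def kernApply {X : Type*} [MeasurableSpace X]
    (κ : Kernel X X) (ω : X → ℝ) (x : X) : ℝ :=
  ∫ y, ω y ∂(κ x)

/-- The continuous function on `[a, ∞)` interpolating `G` linearly between the nodes `a + k * δ`,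
`k ≤ n + 1`, and affine beyond, written as an affine function plus multiples of the hinge functions
`t ↦ max (t - c) 0`. -/
noncomputable def hingeInterp (G : ℝ → ℝ) (a δ : ℝ) : ℕ → ℝ → ℝ
  | 0, t => G a + (G (a + δ) - G a) / δ * (t - a)
  | n + 1, t => hingeInterp G a δ n t +
      (G (a + (n + 2) * δ) - 2 * G (a + (n + 1) * δ) + G (a + n * δ)) / δ *
        max (t - (a + (n + 1) * δ)) 0

lemma hingeInterp_of_le (G : ℝ → ℝ) (a : ℝ) {δ : ℝ} (hδ : 0 < δ) (n : ℕ) {t : ℝ}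
    (ht : a + n * δ ≤ t) :
    hingeInterp G a δ n t =
      G (a + n * δ) + (G (a + (n + 1) * δ) - G (a + n * δ)) / δ * (t - (a + n * δ)) := by
  induction n with
  | zero => simp [hingeInterp]
  | succ n ih =>
    push_cast at ht ⊢
    have h1 : a + n * δ ≤ t := by nlinarith
    rw [hingeInterp, ih h1, max_eq_left (by linarith),
      show a + ((n : ℝ) + 1 + 1) * δ = a + (n + 2) * δ by ring]
    field_simp
    ring

lemma abs_hingeInterp_sub_le {G : ℝ → ℝ} {L : ℝ} (hG : ∀ x y, |G x - G y| ≤ L * |x - y|)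
    (hL : 0 ≤ L) (a : ℝ) {δ : ℝ} (hδ : 0 < δ) (n : ℕ) {t : ℝ} (hat : a ≤ t)
    (ht : t ≤ a + (n + 1) * δ) :
    |hingeInterp G a δ n t - G t| ≤ 2 * L * δ := by
  have key : ∀ n : ℕ, a + n * δ ≤ t → t ≤ a + (n + 1) * δ →
      |hingeInterp G a δ n t - G t| ≤ 2 * L * δ := by
    intro n h1 h2
    rw [hingeInterp_of_le G a hδ n h1]
    have e1 := hG (a + n * δ) t
    have e2 := hG (a + (n + 1) * δ) (a + n * δ)
    have e3 : |a + n * δ - t| ≤ δ := by rw [abs_le]; constructor <;> linarith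
    have e4 : |a + (n + 1) * δ - (a + n * δ)| = δ := by
      rw [show a + (n + 1) * δ - (a + n * δ) = δ by ring, abs_of_pos hδ]
    rw [e4] at e2
    have e5 : |(G (a + (n + 1) * δ) - G (a + n * δ)) / δ * (t - (a + n * δ))| ≤ L * δ := by
      rw [abs_mul, abs_div, abs_of_pos hδ, abs_sub_comm t]
      exact mul_le_mul ((div_le_iff₀ hδ).2 e2) e3 (abs_nonneg _) hL
    have e6 : |G (a + n * δ) - G t| ≤ L * δ := e1.trans (by gcongr)
    rw [add_sub_right_comm]
    exact (abs_add_le _ _).trans (by linarith)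
  induction n with
  | zero => exact key 0 (by simpa using hat) ht
  | succ n ih =>
    rcases le_total t (a + (n + 1) * δ) with h | h
    · rw [hingeInterp, max_eq_right (by linarith), mul_zero, add_zero]
      exact ih h
    · exact key (n + 1) (by push_cast; exact h) ht

lemma continuous_hingeInterp (G : ℝ → ℝ) (a δ : ℝ) (n : ℕ) :
    Continuous (hingeInterp G a δ n) := by
  induction n with
  | zero =>
    change Continuous fun t => G a + (G (a + δ) - G a) / δ * (t - a)
    fun_prop
  | succ n ih =>
    change Continuous fun t => hingeInterp G a δ n t + _ * max (t - (a + (n + 1) * δ)) 0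
    fun_prop

lemma Continuous.integrable_of_compactSpace {X : Type*} [TopologicalSpace X] [CompactSpace X]
    [MeasurableSpace X] [OpensMeasurableSpace X] {f : X → ℝ} (hf : Continuous f)
    (μ : Measure X) [IsFiniteMeasure μ] : Integrable f μ :=
  hf.integrable_of_hasCompactSupport (HasCompactSupport.of_compactSpace f)

section ConvexOrder

variable {a b : ℝ} {ν ν₀ : Measure (Set.Icc a b)} [IsFiniteMeasure ν] [IsFiniteMeasure ν₀]

lemma integral_hingeInterp_le (hmass : ν.real Set.univ = ν₀.real Set.univ)
    (hmean : ∫ t, (t : ℝ) ∂ν = ∫ t, (t : ℝ) ∂ν₀)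
    (hpot : ∀ c : ℝ, ∫ t, max ((t : ℝ) - c) 0 ∂ν ≤ ∫ t, max ((t : ℝ) - c) 0 ∂ν₀)
    {G : ℝ → ℝ} (hG : ∀ t δ, 2 * G t ≤ G (t + δ) + G (t - δ)) {δ : ℝ} (hδ : 0 < δ) (n : ℕ) :
    ∫ t, hingeInterp G a δ n t ∂ν ≤ ∫ t, hingeInterp G a δ n t ∂ν₀ := by
  induction n with
  | zero =>
    have key : ∀ (μ : Measure (Set.Icc a b)) [IsFiniteMeasure μ],
        ∫ t, hingeInterp G a δ 0 t ∂μ = μ.real Set.univ * G a +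
          (G (a + δ) - G a) / δ * (∫ t, (t : ℝ) ∂μ - μ.real Set.univ * a) := by
      intro μ _
      have hi : Integrable (fun t : Set.Icc a b => (t : ℝ)) μ :=
        continuous_subtype_val.integrable_of_compactSpace μ
      simp only [hingeInterp]
      rw [integral_add (integrable_const _)
          (Continuous.integrable_of_compactSpace (by fun_prop) μ),
        integral_const_mul, integral_sub hi (integrable_const _)]
      simp
    rw [key ν, key ν₀, hmass, hmean]
  | succ n ih =>
    have key : ∀ (μ : Measure (Set.Icc a b)) [IsFiniteMeasure μ],
        ∫ t, hingeInterp G a δ (n + 1) t ∂μ = ∫ t, hingeInterp G a δ n t ∂μ +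
          (G (a + (n + 2) * δ) - 2 * G (a + (n + 1) * δ) + G (a + n * δ)) / δ *
            ∫ t, max ((t : ℝ) - (a + (n + 1) * δ)) 0 ∂μ := by
      intro μ _
      simp only [hingeInterp]
      rw [integral_add, integral_const_mul]
      · exact ((continuous_hingeInterp G a δ n).comp
          continuous_subtype_val).integrable_of_compactSpace μ
      · exact Continuous.integrable_of_compactSpace (by fun_prop) μ
    rw [key ν, key ν₀]
    have h := hG (a + (n + 1) * δ) δ
    rw [show a + (n + 1) * δ + δ = a + (n + 2) * δ by ring,
      show a + (n + 1) * δ - δ = a + n * δ by ring] at h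
    have h0 : 0 ≤ (G (a + (n + 2) * δ) - 2 * G (a + (n + 1) * δ) + G (a + n * δ)) / δ :=
      div_nonneg (by linarith) hδ.le
    exact add_le_add ih (mul_le_mul_of_nonneg_left (hpot _) h0)

lemma integral_le_of_midpoint_convex (hmass : ν.real Set.univ = ν₀.real Set.univ)
    (hmean : ∫ t, (t : ℝ) ∂ν = ∫ t, (t : ℝ) ∂ν₀)
    (hpot : ∀ c : ℝ, ∫ t, max ((t : ℝ) - c) 0 ∂ν ≤ ∫ t, max ((t : ℝ) - c) 0 ∂ν₀)
    {G : ℝ → ℝ} (hG : ∀ t δ, 2 * G t ≤ G (t + δ) + G (t - δ))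
    {L : ℝ} (hL : 0 ≤ L) (hLip : ∀ x y, |G x - G y| ≤ L * |x - y|) :
    ∫ t, G t ∂ν ≤ ∫ t, G t ∂ν₀ := by
  have hGc : Continuous G :=
    (LipschitzWith.of_dist_le_mul (K := ⟨L, hL⟩) (f := G) hLip).continuous
  have approx : ∀ (μ : Measure (Set.Icc a b)) [IsFiniteMeasure μ] {δ : ℝ}, 0 < δ → ∀ n : ℕ,
      b ≤ a + (n + 1) * δ →
      |∫ t, hingeInterp G a δ n t ∂μ - ∫ t, G t ∂μ| ≤ 2 * L * δ * μ.real Set.univ := by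
    intro μ _ δ hδ n hn
    have hc := continuous_hingeInterp G a δ n
    have h1 : Integrable (fun t : Set.Icc a b => hingeInterp G a δ n t) μ :=
      Continuous.integrable_of_compactSpace (by fun_prop) μ
    have h2 : Integrable (fun t : Set.Icc a b => G t) μ :=
      Continuous.integrable_of_compactSpace (by fun_prop) μ
    rw [← integral_sub h1 h2]
    have h3 : ∀ᵐ t : Set.Icc a b ∂μ, ‖hingeInterp G a δ n t - G t‖ ≤ 2 * L * δ :=
      Filter.Eventually.of_forall fun t =>
        abs_hingeInterp_sub_le hLip hL a hδ n t.2.1 (t.2.2.trans hn)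
    exact norm_integral_le_of_norm_le_const h3
  refine le_of_forall_pos_le_add fun ε hε => ?_
  set m := ν₀.real Set.univ
  have hm0 : 0 ≤ m := measureReal_nonneg
  set δ := ε / (4 * L * m + 1)
  have hden : 0 < 4 * L * m + 1 := by positivity
  have hδ : 0 < δ := by positivity
  have hδε : 4 * L * m * δ ≤ ε := by
    have : δ * (4 * L * m + 1) = ε := div_mul_cancel₀ _ hden.ne'
    nlinarith
  obtain ⟨n, hn⟩ := exists_nat_ge ((b - a) / δ)
  have hn' : b ≤ a + (n + 1) * δ := by
    rw [div_le_iff₀ hδ] at hn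
    linarith
  have h1 := abs_le.1 (approx ν hδ n hn')
  have h2 := abs_le.1 (approx ν₀ hδ n hn')
  have h3 := integral_hingeInterp_le hmass hmean hpot hG hδ n
  rw [hmass] at h1
  linarith [h1.1, h2.2]

/-- The duality inequality behind Strassen's theorem: if `ν` is dominated by `ν₀` in the convex
order and `ψ x + φ y + h x * (y - x)` is nonnegative, then so is `∫ ψ dν + ∫ φ dν₀`. -/
lemma integral_add_integral_nonneg (hmass : ν.real Set.univ = ν₀.real Set.univ)
    (hmean : ∫ t, (t : ℝ) ∂ν = ∫ t, (t : ℝ) ∂ν₀)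
    (hpot : ∀ c : ℝ, ∫ t, max ((t : ℝ) - c) 0 ∂ν ≤ ∫ t, max ((t : ℝ) - c) 0 ∂ν₀)
    (ψ φ h : C(Set.Icc a b, ℝ))
    (H : ∀ x y : Set.Icc a b, 0 ≤ ψ x + φ y + h x * ((y : ℝ) - x)) :
    0 ≤ ∫ t, ψ t ∂ν + ∫ t, φ t ∂ν₀ := by
  rcases isEmpty_or_nonempty (Set.Icc a b) with hE | hE
  · simp [Measure.eq_zero_of_isEmpty]
  set G : ℝ → ℝ := fun y => ⨆ x : Set.Icc a b, (-ψ x - h x * (y - x))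
  have hbdd : ∀ y : ℝ, BddAbove (Set.range fun x : Set.Icc a b => -ψ x - h x * (y - x)) :=
    fun y => (isCompact_range (by fun_prop)).bddAbove
  have hle : ∀ (y : ℝ) (x : Set.Icc a b), -ψ x - h x * (y - x) ≤ G y :=
    fun y x => le_ciSup (hbdd y) x
  have hmid : ∀ t δ, 2 * G t ≤ G (t + δ) + G (t - δ) := by
    intro t δ
    have : G t ≤ (G (t + δ) + G (t - δ)) / 2 := ciSup_le fun x => by
      linarith [hle (t + δ) x, hle (t - δ) x]
    linarith
  have hone : ∀ s t, G s ≤ G t + ‖h‖ * |s - t| := fun s t => ciSup_le fun x => by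
    have h1 := hle t x
    have h2 : -(h x * (s - t)) ≤ ‖h‖ * |s - t| := by
      refine (neg_le_abs _).trans ?_
      rw [abs_mul]
      exact mul_le_mul_of_nonneg_right (h.norm_coe_le_norm x) (abs_nonneg _)
    linarith
  have hLip : ∀ s t, |G s - G t| ≤ ‖h‖ * |s - t| := by
    intro s t
    rw [abs_le]
    constructor
    · have := hone t s
      rw [abs_sub_comm] at this
      linarith
    · linarith [hone s t]
  have hGc : Continuous fun t : Set.Icc a b => G t :=
    (LipschitzWith.of_dist_le_mul (K := ‖h‖₊) (f := G) hLip).continuous.comp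
      continuous_subtype_val
  have h1 := integral_le_of_midpoint_convex hmass hmean hpot hmid (norm_nonneg h) hLip
  have h2 : ∫ t, G t ∂ν₀ ≤ ∫ t, φ t ∂ν₀ :=
    integral_mono (hGc.integrable_of_compactSpace _) (φ.continuous.integrable_of_compactSpace _)
      fun y => ciSup_le fun x => by linarith [H x y]
  have h3 : ∫ t, -ψ t ∂ν ≤ ∫ t, G t ∂ν :=
    integral_mono (ψ.continuous.neg.integrable_of_compactSpace _)
      (hGc.integrable_of_compactSpace _) fun x => by simpa using hle x x
  rw [integral_neg] at h3
  linarith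

/-- The Hahn-Banach step of Strassen's theorem. The functional is dominated by the cheapest
`∫ ψ dν + ∫ φ dν₀` among the upper bounds `ψ x + φ y + h x * (y - x)` of its argument. -/
lemma exists_martingale_functional (hmass : ν.real Set.univ = ν₀.real Set.univ)
    (hmean : ∫ t, (t : ℝ) ∂ν = ∫ t, (t : ℝ) ∂ν₀)
    (hpot : ∀ c : ℝ, ∫ t, max ((t : ℝ) - c) 0 ∂ν ≤ ∫ t, max ((t : ℝ) - c) 0 ∂ν₀) :
    ∃ Λ : C(Set.Icc a b × Set.Icc a b, ℝ) →ₗ[ℝ] ℝ,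
      ∀ (F : C(Set.Icc a b × Set.Icc a b, ℝ)) (ψ φ h : C(Set.Icc a b, ℝ)),
        (∀ x y : Set.Icc a b, F (x, y) ≤ ψ x + φ y + h x * ((y : ℝ) - x)) →
        Λ F ≤ ∫ t, ψ t ∂ν + ∫ t, φ t ∂ν₀ := by
  have hint : ∀ (μ : Measure (Set.Icc a b)) [IsFiniteMeasure μ] (ψ : C(Set.Icc a b, ℝ)),
      Integrable ψ μ := fun μ _ ψ => ψ.continuous.integrable_of_compactSpace μ
  let S : C(Set.Icc a b × Set.Icc a b, ℝ) → Set ℝ := fun F =>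
    {r | ∃ ψ φ h : C(Set.Icc a b, ℝ),
      (∀ x y : Set.Icc a b, F (x, y) ≤ ψ x + φ y + h x * ((y : ℝ) - x)) ∧
      r = ∫ t, ψ t ∂ν + ∫ t, φ t ∂ν₀}
  have hne : ∀ F, (S F).Nonempty := fun F =>
    ⟨_, ContinuousMap.const _ ‖F‖, 0, 0, fun x y => by
      simpa using (le_abs_self _).trans (F.norm_coe_le_norm (x, y)), rfl⟩
  have hbdd : ∀ F, BddBelow (S F) := by
    refine fun F => ⟨-(‖F‖ * ν.real Set.univ), ?_⟩
    rintro r ⟨ψ, φ, h, H, rfl⟩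
    have := integral_add_integral_nonneg hmass hmean hpot (ψ + ContinuousMap.const _ ‖F‖) φ h
      fun x y => by
        have h1 := (abs_le.1 (F.norm_coe_le_norm (x, y))).1
        have h2 := H x y
        simp only [ContinuousMap.add_apply, ContinuousMap.const_apply]
        linarith
    simp only [ContinuousMap.add_apply, ContinuousMap.const_apply] at this
    rw [integral_add (hint ν ψ) (integrable_const _), integral_const, smul_eq_mul] at this
    linarith
  have hadd : ∀ F F', sInf (S (F + F')) ≤ sInf (S F) + sInf (S F') := by
    intro F F'
    rw [← sub_le_iff_le_add]
    refine le_csInf (hne F) ?_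
    rintro r ⟨ψ, φ, h, H, rfl⟩
    rw [sub_le_comm]
    refine le_csInf (hne F') ?_
    rintro r ⟨ψ', φ', h', H', rfl⟩
    rw [sub_le_iff_le_add]
    refine csInf_le (hbdd _) ⟨ψ + ψ', φ + φ', h + h', fun x y => ?_, ?_⟩
    · simp only [ContinuousMap.add_apply]
      linarith [H x y, H' x y]
    · simp only [ContinuousMap.add_apply]
      rw [integral_add (hint ν ψ) (hint ν ψ'), integral_add (hint ν₀ φ) (hint ν₀ φ')]
      ring
  have hsmul_le : ∀ c : ℝ, 0 < c → ∀ F, sInf (S (c • F)) ≤ c * sInf (S F) := by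
    intro c hc F
    rw [← div_le_iff₀' hc]
    refine le_csInf (hne F) ?_
    rintro r ⟨ψ, φ, h, H, rfl⟩
    rw [div_le_iff₀' hc]
    refine csInf_le (hbdd _) ⟨c • ψ, c • φ, c • h, fun x y => ?_, ?_⟩
    · simp only [ContinuousMap.smul_apply, smul_eq_mul]
      nlinarith [mul_le_mul_of_nonneg_left (H x y) hc.le]
    · simp only [ContinuousMap.smul_apply, smul_eq_mul, integral_const_mul]
      ring
  have hsmul : ∀ c : ℝ, 0 < c → ∀ F, sInf (S (c • F)) = c * sInf (S F) := by
    intro c hc F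
    refine le_antisymm (hsmul_le c hc F) ?_
    have := hsmul_le c⁻¹ (inv_pos.2 hc) (c • F)
    rwa [inv_smul_smul₀ hc.ne', ← div_eq_inv_mul, le_div_iff₀' hc] at this
  have hzero : (0 : ℝ) ≤ sInf (S 0) := by
    refine le_csInf (hne 0) ?_
    rintro r ⟨ψ, φ, h, H, rfl⟩
    exact integral_add_integral_nonneg hmass hmean hpot ψ φ h H
  obtain ⟨Λ, -, hΛ⟩ := exists_extension_of_le_sublinear
    (⊥ : C(Set.Icc a b × Set.Icc a b, ℝ) →ₗ.[ℝ] ℝ) (fun F => sInf (S F)) hsmul hadd (by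
      rintro ⟨x, hx⟩
      obtain rfl : x = 0 := (Submodule.mem_bot ℝ).1 hx
      exact (LinearPMap.map_zero ⊥).trans_le hzero)
  exact ⟨Λ, fun F ψ φ h H => (hΛ F).trans (csInf_le (hbdd F) ⟨ψ, φ, h, H, rfl⟩)⟩

lemma exists_martingale_coupling (hmass : ν.real Set.univ = ν₀.real Set.univ)
    (hmean : ∫ t, (t : ℝ) ∂ν = ∫ t, (t : ℝ) ∂ν₀)
    (hpot : ∀ c : ℝ, ∫ t, max ((t : ℝ) - c) 0 ∂ν ≤ ∫ t, max ((t : ℝ) - c) 0 ∂ν₀) :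
    ∃ π : Measure (Set.Icc a b × Set.Icc a b), IsFiniteMeasure π ∧ π.fst = ν ∧ π.snd = ν₀ ∧
      ∀ h : C(Set.Icc a b, ℝ), ∫ p, h p.1 * ((p.2 : ℝ) - p.1) ∂π = 0 := by
  obtain ⟨Λ, hΛ⟩ := exists_martingale_functional hmass hmean hpot
  have heq : ∀ (F : C(Set.Icc a b × Set.Icc a b, ℝ)) (ψ φ h : C(Set.Icc a b, ℝ)),
      (∀ x y : Set.Icc a b, F (x, y) = ψ x + φ y + h x * ((y : ℝ) - x)) →
      Λ F = ∫ t, ψ t ∂ν + ∫ t, φ t ∂ν₀ := by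
    intro F ψ φ h H
    refine le_antisymm (hΛ F ψ φ h fun x y => (H x y).le) ?_
    have := hΛ (-F) (-ψ) (-φ) (-h) fun x y => by
      simp only [ContinuousMap.neg_apply, H x y]
      linarith
    simp only [ContinuousMap.neg_apply, map_neg, integral_neg] at this
    linarith
  let Λ' : CompactlySupportedContinuousMap (Set.Icc a b × Set.Icc a b) ℝ →ₚ[ℝ] ℝ :=
    PositiveLinearMap.mk₀
      { toFun := fun F => Λ F.toContinuousMap
        map_add' := fun F F' => Λ.map_add F.toContinuousMap F'.toContinuousMap
        map_smul' := fun c F => Λ.map_smul c F.toContinuousMap }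
      fun F hF => by
        have := hΛ (-F.toContinuousMap) 0 0 0 fun x y => by
          simpa using hF (x, y)
        simpa using this
  set π := RealRMK.rieszMeasure Λ'
  have hfin : IsFiniteMeasure π := inferInstance
  have hint : ∀ F : C(Set.Icc a b × Set.Icc a b, ℝ), ∫ p, F p ∂π = Λ F := fun F =>
    RealRMK.integral_rieszMeasure Λ' (CompactlySupportedContinuousMap.continuousMapEquiv F)
  refine ⟨π, hfin, ?_, ?_, fun h => ?_⟩
  · refine ext_of_forall_integral_eq_of_IsFiniteMeasure fun ψ => ?_
    rw [Measure.fst, integral_map measurable_fst.aemeasurable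
      ψ.continuous.aestronglyMeasurable]
    refine (hint (ψ.toContinuousMap.comp ContinuousMap.fst)).trans ?_
    rw [heq _ ψ.toContinuousMap 0 0 fun x y => by simp]
    simp
  · refine ext_of_forall_integral_eq_of_IsFiniteMeasure fun φ => ?_
    rw [Measure.snd, integral_map measurable_snd.aemeasurable
      φ.continuous.aestronglyMeasurable]
    refine (hint (φ.toContinuousMap.comp ContinuousMap.snd)).trans ?_
    rw [heq _ 0 φ.toContinuousMap 0 fun x y => by simp]
    simp
  · refine (hint ⟨fun p => h p.1 * ((p.2 : ℝ) - p.1), by fun_prop⟩).trans ?_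
    rw [heq _ 0 0 h fun x y => by simp]
    simp

lemma ae_eq_of_forall_integral_continuousMap_mul_eq {X : Type*} [TopologicalSpace X]
    [CompactSpace X] [MeasurableSpace X] [BorelSpace X] [HasOuterApproxClosed X]
    {μ : Measure X} [IsFiniteMeasure μ] {f g : X → ℝ} (hf : Measurable f) (hg : Measurable g)
    (hf0 : ∀ x, 0 ≤ f x) (hg0 : ∀ x, 0 ≤ g x) (hfi : Integrable f μ) (hgi : Integrable g μ)
    (H : ∀ h : C(X, ℝ), ∫ x, h x * f x ∂μ = ∫ x, h x * g x ∂μ) : f =ᵐ[μ] g := by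
  have := isFiniteMeasure_withDensity_ofReal hfi.2
  have := isFiniteMeasure_withDensity_ofReal hgi.2
  have key : μ.withDensity (fun x => ENNReal.ofReal (f x)) =
      μ.withDensity fun x => ENNReal.ofReal (g x) := by
    refine ext_of_forall_integral_eq_of_IsFiniteMeasure fun h => ?_
    rw [integral_withDensity_eq_integral_toReal_smul hf.ennreal_ofReal (by simp),
      integral_withDensity_eq_integral_toReal_smul hg.ennreal_ofReal (by simp)]
    simpa [ENNReal.toReal_ofReal, hf0, hg0, mul_comm] using H h.toContinuousMap
  rw [withDensity_eq_iff hf.ennreal_ofReal.aemeasurable hg.ennreal_ofReal.aemeasurable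
    hfi.lintegral_lt_top.ne] at key
  filter_upwards [key] with x hx
  rwa [ENNReal.ofReal_eq_ofReal_iff (hf0 x) (hg0 x)] at hx

/-- **Strassen's theorem** on a compact interval: a measure `ν` dominated by `ν₀` in the convex
order is transported to `ν₀` by a kernel preserving barycenters. -/
lemma exists_martingale_kernel [Nonempty (Set.Icc a b)]
    (hmass : ν.real Set.univ = ν₀.real Set.univ)
    (hmean : ∫ t, (t : ℝ) ∂ν = ∫ t, (t : ℝ) ∂ν₀)
    (hpot : ∀ c : ℝ, ∫ t, max ((t : ℝ) - c) 0 ∂ν ≤ ∫ t, max ((t : ℝ) - c) 0 ∂ν₀) :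
    ∃ P : Kernel (Set.Icc a b) (Set.Icc a b), IsMarkovKernel P ∧ P ∘ₘ ν = ν₀ ∧
      ∀ᵐ x ∂ν, ∫ y, (y : ℝ) ∂(P x) = x := by
  obtain ⟨π, hπ, rfl, rfl, hmart⟩ := exists_martingale_coupling hmass hmean hpot
  refine ⟨π.condKernel, inferInstance, ?_, ?_⟩
  · rw [← Measure.snd_compProd, Measure.disintegrate]
  · have hP : ∀ x, Integrable (fun y : Set.Icc a b => (y : ℝ)) (π.condKernel x) := fun x =>
      continuous_subtype_val.integrable_of_compactSpace _
    have hsm : StronglyMeasurable fun x => ∫ y : Set.Icc a b, (y : ℝ) ∂(π.condKernel x) :=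
      StronglyMeasurable.integral_kernel_prod_right'
        (f := fun p : Set.Icc a b × Set.Icc a b => (p.2 : ℝ))
        (measurable_subtype_coe.comp measurable_snd).stronglyMeasurable
    have hlow : ∀ x, a ≤ ∫ y : Set.Icc a b, (y : ℝ) ∂(π.condKernel x) := fun x => by
      have := integral_mono (integrable_const a) (hP x) fun y => y.2.1
      simpa using this
    have hup : ∀ x, ∫ y : Set.Icc a b, (y : ℝ) ∂(π.condKernel x) ≤ b := fun x => by
      have := integral_mono (hP x) (integrable_const b) fun y => y.2.2
      simpa using this
    have hbd : Integrable (fun x => ∫ y : Set.Icc a b, (y : ℝ) ∂(π.condKernel x)) π.fst :=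
      Integrable.of_mem_Icc a b hsm.measurable.aemeasurable
        (Filter.Eventually.of_forall fun x => ⟨hlow x, hup x⟩)
    have hid : Integrable (fun x : Set.Icc a b => (x : ℝ)) π.fst :=
      continuous_subtype_val.integrable_of_compactSpace _
    have hae := ae_eq_of_forall_integral_continuousMap_mul_eq (μ := π.fst)
      (f := fun x => ∫ y : Set.Icc a b, (y : ℝ) ∂(π.condKernel x) - a) (g := fun x => (x : ℝ) - a)
      (hsm.measurable.sub_const a) (measurable_subtype_coe.sub_const a)
      (fun x => sub_nonneg.2 (hlow x)) (fun x => sub_nonneg.2 x.2.1)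
      (hbd.sub (integrable_const a)) (hid.sub (integrable_const a)) fun h => by
        have hc : Integrable (fun p : Set.Icc a b × Set.Icc a b => h p.1 * ((p.2 : ℝ) - p.1)) π :=
          Continuous.integrable_of_compactSpace (by fun_prop) π
        have h0 := hmart h
        rw [← π.disintegrate π.condKernel] at h0 hc
        rw [Measure.integral_compProd hc] at h0
        have hmul : ∀ {k : Set.Icc a b → ℝ}, Integrable k π.fst →
            Integrable (fun x => h x * k x) π.fst := fun hk =>
          hk.bdd_mul h.continuous.aestronglyMeasurable
            (Filter.Eventually.of_forall fun x => h.norm_coe_le_norm x)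
        have h1 := hmul (hbd.sub (integrable_const a))
        have h2 := hmul (hid.sub (integrable_const a))
        simp only [Pi.sub_apply] at h1 h2
        rw [← sub_eq_zero, ← integral_sub h1 h2, ← h0]
        refine integral_congr_ae (Filter.Eventually.of_forall fun x => ?_)
        simp only
        rw [integral_const_mul, integral_sub (hP x) (integrable_const _)]
        simp
        ring
    filter_upwards [hae] with x hx
    simpa using hx

end ConvexOrder

lemma MeasureTheory.MemLp.exists_measurable_Icc_ae_eq {X : Type*} [MeasurableSpace X]
    {μ : Measure X} {f : X → ℝ} (hf : MemLp f ⊤ μ) {R : ℝ} (hR : (eLpNorm f ⊤ μ).toReal ≤ R) :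
    ∃ g : X → Set.Icc (-R) R, Measurable g ∧ f =ᵐ[μ] fun x => (g x : ℝ) := by
  have hR0 : -R ≤ R := neg_le_self (ENNReal.toReal_nonneg.trans hR)
  refine ⟨fun x => Set.projIcc (-R) R hR0 (hf.1.mk f x),
    continuous_projIcc.measurable.comp hf.1.stronglyMeasurable_mk.measurable, ?_⟩
  have hbd : ∀ᵐ x ∂μ, ‖f x‖ ≤ (eLpNorm f ⊤ μ).toReal := by
    rw [eLpNorm_exponent_top]
    filter_upwards [ae_le_eLpNormEssSup (f := f) (μ := μ)] with x hx
    have h2 : eLpNormEssSup f μ ≠ ⊤ := by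
      have := hf.2.ne
      rwa [eLpNorm_exponent_top] at this
    simpa using ENNReal.toReal_mono h2 hx
  filter_upwards [hf.1.ae_eq_mk, hbd] with x hx hb
  rw [← hx, Set.projIcc_of_mem hR0 (Set.mem_Icc.2 (abs_le.1 (hb.trans hR)))]

section Bistochastic

variable {X : Type*} [MeasurableSpace X] {μ : Measure X} {κ : Kernel X X}

lemma IsBistochastic.comp_eq (hκ : IsBistochastic μ κ) : κ ∘ₘ μ = μ := by
  ext A hA
  rw [Measure.bind_apply hA κ.aemeasurable, hκ.2 A hA]

lemma MeasureTheory.Measure.integral_comp_kernel {Y : Type*} [MeasurableSpace Y]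
    {η : Kernel X Y} {f : Y → ℝ}
    (hf : Integrable f (η ∘ₘ μ)) : ∫ y, f y ∂(η ∘ₘ μ) = ∫ x, ∫ y, f y ∂(η x) ∂μ := by
  rw [Measure.comp_eq_comp_const_apply] at hf ⊢
  rw [Kernel.integral_comp hf, Kernel.const_apply]

lemma MeasureTheory.Integrable.integral_comp_kernel {Y : Type*} [MeasurableSpace Y]
    {η : Kernel X Y} {f : Y → ℝ}
    (hf : Integrable f (η ∘ₘ μ)) : Integrable (fun x => ∫ y, f y ∂(η x)) μ := by
  rw [Measure.comp_eq_comp_const_apply] at hf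
  simpa using hf.integral_comp

lemma IsBistochastic.integral_kernApply (hκ : IsBistochastic μ κ) {f : X → ℝ}
    (hf : Integrable f μ) : ∫ x, kernApply κ f x ∂μ = ∫ x, f x ∂μ := by
  rw [← hκ.comp_eq] at hf
  conv_rhs => rw [← hκ.comp_eq]
  exact (Measure.integral_comp_kernel hf).symm

lemma IsBistochastic.integral_max_kernApply_le [IsFiniteMeasure μ] (hκ : IsBistochastic μ κ)
    {f : X → ℝ} (hf : Integrable f μ) (c : ℝ) :
    ∫ x, max (kernApply κ f x - c) 0 ∂μ ≤ ∫ x, max (f x - c) 0 ∂μ := by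
  have := hκ.1
  have hpos : Integrable (fun x => max (f x - c) 0) μ := (hf.sub (integrable_const c)).pos_part
  have hf' := hf
  have hpos' := hpos
  rw [← hκ.comp_eq] at hf' hpos'
  rw [← hκ.integral_kernApply hpos]
  refine integral_mono_ae (hf'.integral_comp_kernel.sub (integrable_const c)).pos_part
    hpos'.integral_comp_kernel ?_
  filter_upwards [Measure.ae_integrable_of_integrable_comp hf',
    Measure.ae_integrable_of_integrable_comp hpos'] with x h1 h2
  refine max_le ?_ (integral_nonneg fun y => le_max_right _ _)
  have h3 : ∫ y, (f y - c) ∂(κ x) = kernApply κ f x - c := by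
    rw [integral_sub h1 (integrable_const c)]
    simp [kernApply]
  rw [← h3]
  exact integral_mono (h1.sub (integrable_const c)) h2 fun y => le_max_left _ _

/-- If `f` is dominated by `f₀` in the convex order, compose a barycenter-preserving kernel from the
law of `f` to the law of `f₀` with the conditional distribution given `f₀`. -/
lemma exists_isBistochastic_of_convex_order [StandardBorelSpace X] [IsFiniteMeasure μ]
    {a b : ℝ} {f₀ f : X → Set.Icc a b} (hf₀ : Measurable f₀) (hf : Measurable f)
    (hmean : ∫ x, (f x : ℝ) ∂μ = ∫ x, (f₀ x : ℝ) ∂μ)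
    (hpot : ∀ c : ℝ, ∫ x, max ((f x : ℝ) - c) 0 ∂μ ≤ ∫ x, max ((f₀ x : ℝ) - c) 0 ∂μ) :
    ∃ κ : Kernel X X, IsBistochastic μ κ ∧
      ∀ᵐ x ∂μ, ∫ y, (f₀ y : ℝ) ∂(κ x) = f x := by
  rcases isEmpty_or_nonempty X with hX | hX
  · refine ⟨Kernel.id, ⟨inferInstance, fun A _ => ?_⟩, ?_⟩ <;> simp [Measure.eq_zero_of_isEmpty]
  have : Nonempty (Set.Icc a b) := ⟨f hX.some⟩
  have hmap : ∀ {g : X → Set.Icc a b} (_ : Measurable g) {F : ℝ → ℝ} (_ : Continuous F),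
      ∫ t, F t ∂(μ.map g) = ∫ x, F (g x) ∂μ := fun hg F hF =>
    integral_map hg.aemeasurable (hF.comp continuous_subtype_val).aestronglyMeasurable
  obtain ⟨P, hP, hPν, hPmean⟩ := exists_martingale_kernel (ν := μ.map f) (ν₀ := μ.map f₀)
    (by simp [Measure.real, Measure.map_apply, hf, hf₀])
    ((hmap hf continuous_id).trans (hmean.trans (hmap hf₀ continuous_id).symm))
    (fun c => by
      have hc : Continuous fun t : ℝ => max (t - c) 0 := by fun_prop
      rw [hmap hf hc, hmap hf₀ hc]
      exact hpot c)
  set D := condDistrib id f₀ μ with hD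
  have hDν : D ∘ₘ μ.map f₀ = μ := by
    rw [hD, condDistrib_comp_map hf₀.aemeasurable aemeasurable_id, Measure.map_id]
  have hDfib : ∀ᵐ t ∂(μ.map f₀), ∀ᵐ y ∂(D t), f₀ y = t := by
    refine Measure.ae_ae_of_ae_compProd (p := fun q : Set.Icc a b × X => f₀ q.2 = q.1) ?_
    rw [hD, compProd_map_condDistrib aemeasurable_id, ae_map_iff (by fun_prop)
      (measurableSet_eq_fun (by fun_prop) (by fun_prop))]
    exact Filter.Eventually.of_forall fun x => rfl
  rw [← hPν] at hDfib
  have hint : ∀ (ρ : Measure X) [IsFiniteMeasure ρ], Integrable (fun y => (f₀ y : ℝ)) ρ :=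
    fun ρ _ => Integrable.of_mem_Icc a b (measurable_subtype_coe.comp hf₀).aemeasurable
      (Filter.Eventually.of_forall fun y => (f₀ y).2)
  refine ⟨(D ∘ₖ P).comap f hf, ⟨inferInstance, fun A hA => ?_⟩, ?_⟩
  · simp only [Kernel.comap_apply]
    rw [← lintegral_map ((D ∘ₖ P).measurable_coe hA) hf,
      ← Measure.bind_apply hA (D ∘ₖ P).aemeasurable, ← Measure.comp_assoc, hPν, hDν]
  · simp only [Kernel.comap_apply]
    refine ae_of_ae_map (p := fun s => ∫ y, (f₀ y : ℝ) ∂((D ∘ₖ P) s) = s) hf.aemeasurable ?_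
    filter_upwards [hPmean, Measure.ae_ae_of_ae_comp hDfib] with s hs hfib
    rw [Kernel.integral_comp (hint _), ← hs]
    refine integral_congr_ae ?_
    filter_upwards [hfib] with t ht
    rw [integral_congr_ae (g := fun _ => (t : ℝ)) (by filter_upwards [ht] with y hy; rw [hy])]
    simp

end Bistochastic

/-- for `ω₀, ω ∈ L^∞(M)` on a bounded open `M ⊂ ℝ²`,
`ω = Kω₀` for some bistochastic kernel `K` iff the means agree and all the
positive-part integral inequalities hold. -/
theorem orbit_closure_characterization
    (M : Set (ℝ × ℝ)) (hMopen : IsOpen M) (hMbdd : Bornology.IsBounded M)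
    (ω₀ ω : ℝ × ℝ → ℝ)
    (hω₀ : MemLp ω₀ ⊤ (volume.restrict M)) (hω : MemLp ω ⊤ (volume.restrict M)) :
    (∃ κ : Kernel (ℝ × ℝ) (ℝ × ℝ), IsBistochastic (volume.restrict M) κ ∧
        ω =ᵐ[volume.restrict M] kernApply κ ω₀) ↔
    ((∫ x, ω x ∂(volume.restrict M) = ∫ x, ω₀ x ∂(volume.restrict M)) ∧
      ∀ c : ℝ, ∫ x, max (ω x - c) 0 ∂(volume.restrict M)
          ≤ ∫ x, max (ω₀ x - c) 0 ∂(volume.restrict M)) := by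
  have : IsFiniteMeasure (volume.restrict M) := by
    rw [isFiniteMeasure_restrict]
    exact hMbdd.measure_lt_top.ne
  constructor
  · rintro ⟨κ, hκ, hωκ⟩
    have hint : Integrable ω₀ (volume.restrict M) := hω₀.integrable le_top
    refine ⟨(integral_congr_ae hωκ).trans (hκ.integral_kernApply hint), fun c => ?_⟩
    refine le_of_eq_of_le (integral_congr_ae ?_) (hκ.integral_max_kernApply_le hint c)
    filter_upwards [hωκ] with x hx
    rw [hx]
  · rintro ⟨hmean, hpot⟩
    obtain ⟨f₀, hf₀, hf₀eq⟩ := hω₀.exists_measurable_Icc_ae_eq (le_max_left _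
      (eLpNorm ω ⊤ (volume.restrict M)).toReal)
    obtain ⟨f, hf, hfeq⟩ := hω.exists_measurable_Icc_ae_eq (le_max_right
      (eLpNorm ω₀ ⊤ (volume.restrict M)).toReal _)
    have hcongr : ∀ {u v : ℝ × ℝ → ℝ}, u =ᵐ[volume.restrict M] v → ∀ c : ℝ,
        ∫ x, max (u x - c) 0 ∂(volume.restrict M) =
          ∫ x, max (v x - c) 0 ∂(volume.restrict M) := fun huv c =>
      integral_congr_ae (by filter_upwards [huv] with x hx; rw [hx])
    obtain ⟨κ, hκ, hκf⟩ := exists_isBistochastic_of_convex_order hf₀ hf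
      (by rw [← integral_congr_ae hfeq, ← integral_congr_ae hf₀eq, hmean])
      (fun c => by
        rw [← hcongr hfeq, ← hcongr hf₀eq]
        exact hpot c)
    refine ⟨κ, hκ, ?_⟩
    have hae : ∀ᵐ y ∂(κ ∘ₘ volume.restrict M), ω₀ y = f₀ y := by rwa [hκ.comp_eq]
    filter_upwards [hfeq, hκf, Measure.ae_ae_of_ae_comp hae] with x h1 h2 h3
    rw [h1, ← h2]
    exact (integral_congr_ae h3).symm
end

section
/- Let M ⊂ ℝ² be a bounded open connected set with smooth boundary, equipped with Lebesgue measure λ, and let ω₀ ∈ L^∞(M). Then for ω ∈ L^∞(M) the following are equivalent: (a) there exists a sequence (φ_n) of C^∞ diffeomorphisms of M preserving λ such that ω₀ ∘ φ_n converges to ω in the weak-* topology of L^∞(M) (that is, ∫_M g (ω₀∘φ_n) dλ → ∫_M g ω dλ for every g ∈ L¹(M)); (b) there exists a bistochastic kernel K on M with ω = Kω₀ almost everywhere. -/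
open MeasureTheory ProbabilityTheory

/-- `M` has smooth boundary: it is the sublevel set of a smooth defining function
whose differential does not vanish on the boundary. -/
def HasSmoothBoundary (M : Set (ℝ × ℝ)) : Prop :=
  ∃ f : ℝ × ℝ → ℝ, ContDiff ℝ (⊤ : ℕ∞) f ∧ M = {x | f x < 0} ∧
    ∀ x ∈ frontier M, fderiv ℝ f x ≠ 0

/-- A `C^∞` diffeomorphism of `M` preserving Lebesgue measure. -/
def IsSmoothAPDiffeo (M : Set (ℝ × ℝ)) (φ : ℝ × ℝ → ℝ × ℝ) : Prop :=
  Set.BijOn φ M M ∧ ContDiffOn ℝ (⊤ : ℕ∞) φ M ∧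
    (∃ ψ : ℝ × ℝ → ℝ × ℝ, ContDiffOn ℝ (⊤ : ℕ∞) ψ M ∧ (∀ x ∈ M, ψ (φ x) = x) ∧
      ∀ x ∈ M, φ (ψ x) = x) ∧
    MeasurePreserving φ (volume.restrict M) (volume.restrict M)

open Set Filter Topology
open scoped BoundedContinuousFunction

section SmoothTwist

open scoped ContDiff

lemma IsSmoothAPDiffeo.id (M : Set (ℝ × ℝ)) : IsSmoothAPDiffeo M id :=
  ⟨Set.bijOn_id M, contDiffOn_id, ⟨_root_.id, contDiffOn_id, fun _ _ => rfl, fun _ _ => rfl⟩,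
    MeasurePreserving.id _⟩

lemma IsSmoothAPDiffeo.comp {M : Set (ℝ × ℝ)} {φ χ : ℝ × ℝ → ℝ × ℝ}
    (hφ : IsSmoothAPDiffeo M φ) (hχ : IsSmoothAPDiffeo M χ) : IsSmoothAPDiffeo M (φ ∘ χ) := by
  obtain ⟨hφb, hφs, ⟨ψ, hψs, hψφ, hφψ⟩, hφm⟩ := hφ
  obtain ⟨hχb, hχs, ⟨ξ, hξs, hξχ, hχξ⟩, hχm⟩ := hχ
  have hψM : MapsTo ψ M M := by
    intro y hy
    obtain ⟨x, hx, rfl⟩ := hφb.surjOn hy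
    rwa [hψφ x hx]
  refine ⟨hφb.comp hχb, hφs.comp hχs hχb.mapsTo, ⟨ξ ∘ ψ, hξs.comp hψs hψM, ?_, ?_⟩,
    hφm.comp hχm⟩
  · intro x hx
    simp [hψφ _ (hχb.mapsTo hx), hξχ x hx]
  · intro x hx
    simp [hχξ _ (hψM hx), hφψ x hx]

/-- Determinant of a linear map of the plane given by its two coordinate forms. -/
lemma det_prod_fst_snd (a b c d : ℝ) :
    ((a • ContinuousLinearMap.fst ℝ ℝ ℝ + b • ContinuousLinearMap.snd ℝ ℝ ℝ).prod
      (c • ContinuousLinearMap.fst ℝ ℝ ℝ + d • ContinuousLinearMap.snd ℝ ℝ ℝ)).det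
      = a * d - b * c := by
  have h := Matrix.toLin_finTwoProd_toContinuousLinearMap a b c d
  rw [← h, ContinuousLinearMap.det, LinearMap.coe_toContinuousLinearMap, LinearMap.det_toLin,
    Matrix.det_fin_two_of]

/-- The twist map of the plane, rotating the circle `|z|² = ρ` by the angle `θ ρ`. -/
noncomputable def planeTwist (θ : ℝ → ℝ) (z : ℝ × ℝ) : ℝ × ℝ :=
  (Real.cos (θ (z.1 ^ 2 + z.2 ^ 2)) * z.1 - Real.sin (θ (z.1 ^ 2 + z.2 ^ 2)) * z.2,
    Real.sin (θ (z.1 ^ 2 + z.2 ^ 2)) * z.1 + Real.cos (θ (z.1 ^ 2 + z.2 ^ 2)) * z.2)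

lemma planeTwist_normSq (θ : ℝ → ℝ) (z : ℝ × ℝ) :
    (planeTwist θ z).1 ^ 2 + (planeTwist θ z).2 ^ 2 = z.1 ^ 2 + z.2 ^ 2 := by
  simp only [planeTwist]
  linear_combination (z.1 ^ 2 + z.2 ^ 2) * Real.sin_sq_add_cos_sq (θ (z.1 ^ 2 + z.2 ^ 2))

lemma planeTwist_neg_comp (θ : ℝ → ℝ) (z : ℝ × ℝ) : planeTwist (-θ) (planeTwist θ z) = z := by
  have h := planeTwist_normSq θ z
  rw [planeTwist, h]
  simp only [planeTwist, Pi.neg_apply, Real.cos_neg, Real.sin_neg]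
  have := Real.sin_sq_add_cos_sq (θ (z.1 ^ 2 + z.2 ^ 2))
  ext
  · simp only; linear_combination z.1 * this
  · simp only; linear_combination z.2 * this

lemma planeTwist_eq_self {θ : ℝ → ℝ} {z : ℝ × ℝ} (h : θ (z.1 ^ 2 + z.2 ^ 2) = 0) :
    planeTwist θ z = z := by
  simp [planeTwist, h]

lemma planeTwist_eq_neg {θ : ℝ → ℝ} {z : ℝ × ℝ} (h : θ (z.1 ^ 2 + z.2 ^ 2) = Real.pi) :
    planeTwist θ z = -z := by
  simp [planeTwist, h, Prod.ext_iff]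

lemma contDiff_planeTwist {θ : ℝ → ℝ} (hθ : ContDiff ℝ ∞ θ) : ContDiff ℝ ∞ (planeTwist θ) := by
  have h : ContDiff ℝ ∞ fun z : ℝ × ℝ => θ (z.1 ^ 2 + z.2 ^ 2) :=
    hθ.comp (by fun_prop)
  unfold planeTwist
  exact ((h.cos.mul contDiff_fst).sub (h.sin.mul contDiff_snd)).prodMk
    ((h.sin.mul contDiff_fst).add (h.cos.mul contDiff_snd))

lemma exists_hasFDerivAt_planeTwist {θ : ℝ → ℝ} (hθ : Differentiable ℝ θ) (z : ℝ × ℝ) :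
    ∃ L : ℝ × ℝ →L[ℝ] ℝ × ℝ, HasFDerivAt (planeTwist θ) L z ∧ L.det = 1 := by
  set t := θ (z.1 ^ 2 + z.2 ^ 2) with ht
  set t' := deriv θ (z.1 ^ 2 + z.2 ^ 2) with ht'
  set s := Real.sin t with hs
  set c := Real.cos t with hc
  have hsc : s ^ 2 + c ^ 2 = 1 := Real.sin_sq_add_cos_sq t
  have h1 : HasFDerivAt (fun z : ℝ × ℝ => z.1) (ContinuousLinearMap.fst ℝ ℝ ℝ) z := hasFDerivAt_fst
  have h2 : HasFDerivAt (fun z : ℝ × ℝ => z.2) (ContinuousLinearMap.snd ℝ ℝ ℝ) z := hasFDerivAt_snd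
  have hT : HasFDerivAt (fun z : ℝ × ℝ => θ (z.1 ^ 2 + z.2 ^ 2)) _ z :=
    (hθ (z.1 ^ 2 + z.2 ^ 2)).hasDerivAt.comp_hasFDerivAt z ((h1.pow 2).add (h2.pow 2))
  have hu := (hT.cos.mul h1).sub (hT.sin.mul h2)
  have hv := (hT.sin.mul h1).add (hT.cos.mul h2)
  refine ⟨((c - 2 * z.1 * t' * (s * z.1 + c * z.2)) • ContinuousLinearMap.fst ℝ ℝ ℝ
      + (-s - 2 * z.2 * t' * (s * z.1 + c * z.2)) • ContinuousLinearMap.snd ℝ ℝ ℝ).prod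
      ((s + 2 * z.1 * t' * (c * z.1 - s * z.2)) • ContinuousLinearMap.fst ℝ ℝ ℝ
      + (c + 2 * z.2 * t' * (c * z.1 - s * z.2)) • ContinuousLinearMap.snd ℝ ℝ ℝ), ?_, ?_⟩
  · refine HasFDerivAt.prodMk ?_ ?_
    · refine hu.congr_fderiv ?_
      ext <;> simp [← ht, ← ht', ← hs, ← hc] <;> ring
    · refine hv.congr_fderiv ?_
      ext <;> simp [← ht, ← ht', ← hs, ← hc] <;> ring
  · rw [det_prod_fst_snd]
    linear_combination hsc

/-- A diffeomorphism from the plane onto the open box centred at `c` with half-widths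
`A * π / 2` and `B`, whose Jacobian determinant depends only on the radius. -/
noncomputable def planeToBox (c : ℝ × ℝ) (A B : ℝ) (z : ℝ × ℝ) : ℝ × ℝ :=
  (c.1 + A * Real.arctan z.1, c.2 + B * (z.2 / √(1 + (z.1 ^ 2 + z.2 ^ 2))))

/-- The inverse of `planeToBox`. -/
noncomputable def boxToPlane (c : ℝ × ℝ) (A B : ℝ) (x : ℝ × ℝ) : ℝ × ℝ :=
  (Real.tan ((x.1 - c.1) / A),
    ((x.2 - c.2) / B) / (Real.cos ((x.1 - c.1) / A) * √(1 - ((x.2 - c.2) / B) ^ 2)))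

/-- The open box centred at `c` with half-widths `A * π / 2` and `B`. -/
def openBox (c : ℝ × ℝ) (A B : ℝ) : Set (ℝ × ℝ) :=
  Ioo (c.1 - A * (Real.pi / 2)) (c.1 + A * (Real.pi / 2)) ×ˢ Ioo (c.2 - B) (c.2 + B)

lemma isOpen_openBox (c : ℝ × ℝ) (A B : ℝ) : IsOpen (openBox c A B) := isOpen_Ioo.prod isOpen_Ioo

section Box

variable {c : ℝ × ℝ} {A B : ℝ}

lemma boxToPlane_planeToBox (hA : 0 < A) (hB : 0 < B) (z : ℝ × ℝ) :
    boxToPlane c A B (planeToBox c A B z) = z := by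
  obtain ⟨x, y⟩ := z
  have hA' := hA.ne'
  have hB' := hB.ne'
  have hr : 0 < 1 + (x ^ 2 + y ^ 2) := by positivity
  have hx : 0 < 1 + x ^ 2 := by positivity
  have hv : 1 - (y / √(1 + (x ^ 2 + y ^ 2))) ^ 2 = (1 + x ^ 2) / (1 + (x ^ 2 + y ^ 2)) := by
    rw [div_pow, Real.sq_sqrt hr.le]
    field_simp
    ring
  simp only [boxToPlane, planeToBox, add_sub_cancel_left, mul_div_cancel_left₀ _ hA',
    mul_div_cancel_left₀ _ hB', Real.tan_arctan, Real.cos_arctan, hv,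
    Real.sqrt_div hx.le]
  have h1 := (Real.sqrt_pos.2 hr).ne'
  have h2 := (Real.sqrt_pos.2 hx).ne'
  ext <;> simp only
  field_simp

lemma mem_openBox_iff (hA : 0 < A) (hB : 0 < B) {x : ℝ × ℝ} : x ∈ openBox c A B ↔
    (x.1 - c.1) / A ∈ Ioo (-(Real.pi / 2)) (Real.pi / 2) ∧ (x.2 - c.2) / B ∈ Ioo (-1) 1 := by
  simp only [openBox, mem_prod, mem_Ioo, lt_div_iff₀ hA, div_lt_iff₀ hA, lt_div_iff₀ hB,
    div_lt_iff₀ hB]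
  constructor <;> rintro ⟨⟨h1, h2⟩, h3, h4⟩ <;> refine ⟨⟨?_, ?_⟩, ?_, ?_⟩ <;> nlinarith

lemma planeToBox_boxToPlane (hA : 0 < A) (hB : 0 < B) {x : ℝ × ℝ} (hx : x ∈ openBox c A B) :
    planeToBox c A B (boxToPlane c A B x) = x := by
  obtain ⟨ht, hv⟩ := (mem_openBox_iff hA hB).1 hx
  set t := (x.1 - c.1) / A with htdef
  set v := (x.2 - c.2) / B with hvdef
  clear_value t v
  have hcos : 0 < Real.cos t := Real.cos_pos_of_mem_Ioo ht
  have hw : 0 < 1 - v ^ 2 := by nlinarith [hv.1, hv.2]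
  have hs := Real.sqrt_pos.2 hw
  have hr : 1 + ((Real.tan t) ^ 2 + (v / (Real.cos t * √(1 - v ^ 2))) ^ 2)
      = (1 / (Real.cos t * √(1 - v ^ 2))) ^ 2 := by
    rw [Real.tan_eq_sin_div_cos, div_pow, div_pow, div_pow, mul_pow, Real.sq_sqrt hw.le]
    field_simp
    linear_combination (1 - v ^ 2) * Real.sin_sq_add_cos_sq t
  simp only [boxToPlane, planeToBox, ← htdef, ← hvdef]
  rw [hr, Real.sqrt_sq (by positivity), Real.arctan_tan ht.1 ht.2]
  ext
  · simp only [htdef]; field_simp; ring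
  · simp only
    rw [div_div_div_cancel_right₀ (by positivity), div_one, hvdef]
    field_simp; ring

lemma planeToBox_mem (hA : 0 < A) (hB : 0 < B) (z : ℝ × ℝ) :
    planeToBox c A B z ∈ openBox c A B := by
  rw [mem_openBox_iff hA hB]
  simp only [planeToBox, add_sub_cancel_left, mul_div_cancel_left₀ _ hA.ne',
    mul_div_cancel_left₀ _ hB.ne']
  refine ⟨⟨Real.neg_pi_div_two_lt_arctan _, Real.arctan_lt_pi_div_two _⟩, ?_⟩
  have hr : 0 < 1 + (z.1 ^ 2 + z.2 ^ 2) := by positivity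
  have hlt : |z.2| < √(1 + (z.1 ^ 2 + z.2 ^ 2)) := by
    apply Real.lt_sqrt_of_sq_lt
    rw [sq_abs]; nlinarith [sq_nonneg z.1]
  have := abs_lt.1 hlt
  rw [mem_Ioo, lt_div_iff₀ (Real.sqrt_pos.2 hr), div_lt_iff₀ (Real.sqrt_pos.2 hr)]
  constructor <;> linarith [this.1, this.2]

lemma contDiff_planeToBox (c : ℝ × ℝ) (A B : ℝ) : ContDiff ℝ ∞ (planeToBox c A B) := by
  have hr : ∀ z : ℝ × ℝ, 1 + (z.1 ^ 2 + z.2 ^ 2) ≠ 0 := fun z => by positivity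
  have h1 : ContDiff ℝ ∞ fun z : ℝ × ℝ => 1 + (z.1 ^ 2 + z.2 ^ 2) := by fun_prop
  have h2 := h1.sqrt hr
  have h3 : ContDiff ℝ ∞ fun z : ℝ × ℝ => z.2 / √(1 + (z.1 ^ 2 + z.2 ^ 2)) :=
    contDiff_snd.div h2 fun z => (Real.sqrt_pos.2 (by positivity)).ne'
  exact (contDiff_const.add (contDiff_const.mul (Real.contDiff_arctan.comp contDiff_fst))).prodMk
    (contDiff_const.add (contDiff_const.mul h3))

lemma contDiffOn_boxToPlane (hA : 0 < A) (hB : 0 < B) :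
    ContDiffOn ℝ ∞ (boxToPlane c A B) (openBox c A B) := by
  intro x hx
  obtain ⟨ht, hv⟩ := (mem_openBox_iff hA hB).1 hx
  have hcos : 0 < Real.cos ((x.1 - c.1) / A) := Real.cos_pos_of_mem_Ioo ht
  have hw : 0 < 1 - ((x.2 - c.2) / B) ^ 2 := by nlinarith [hv.1, hv.2]
  have h1 : ContDiff ℝ ∞ fun x : ℝ × ℝ => (x.1 - c.1) / A := by fun_prop
  have h2 : ContDiff ℝ ∞ fun x : ℝ × ℝ => (x.2 - c.2) / B := by fun_prop
  have h3 : ContDiff ℝ ∞ fun x : ℝ × ℝ => 1 - ((x.2 - c.2) / B) ^ 2 := by fun_prop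
  have h4 := h3.contDiffAt (x := x) |>.sqrt hw.ne'
  refine ContDiffAt.contDiffWithinAt (ContDiffAt.prodMk ?_ ?_)
  · exact ContDiffAt.comp (g := Real.tan) x (Real.contDiffAt_tan.2 hcos.ne') h1.contDiffAt
  · exact h2.contDiffAt.div (h1.cos.contDiffAt.mul h4)
      (mul_pos hcos (Real.sqrt_pos.2 hw)).ne'

lemma exists_hasFDerivAt_planeToBox (c : ℝ × ℝ) (A B : ℝ) (z : ℝ × ℝ) :
    ∃ L : ℝ × ℝ →L[ℝ] ℝ × ℝ, HasFDerivAt (planeToBox c A B) L z ∧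
      L.det = A * B / √(1 + (z.1 ^ 2 + z.2 ^ 2)) ^ 3 := by
  have hr : 0 < 1 + (z.1 ^ 2 + z.2 ^ 2) := by positivity
  set r := √(1 + (z.1 ^ 2 + z.2 ^ 2)) with hrdef
  have hrpos : 0 < r := Real.sqrt_pos.2 hr
  have hrsq : r ^ 2 = 1 + (z.1 ^ 2 + z.2 ^ 2) := Real.sq_sqrt hr.le
  have h1 : HasFDerivAt (fun z : ℝ × ℝ => z.1) (ContinuousLinearMap.fst ℝ ℝ ℝ) z := hasFDerivAt_fst
  have h2 : HasFDerivAt (fun z : ℝ × ℝ => z.2) (ContinuousLinearMap.snd ℝ ℝ ℝ) z := hasFDerivAt_snd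
  have hS := ((((h1.pow 2).add (h2.pow 2)).const_add 1).sqrt hr.ne')
  have hu := (h1.arctan.const_mul A).const_add c.1
  have hv := ((h2.mul ((hasDerivAt_inv hrpos.ne').comp_hasFDerivAt z hS)).const_mul B).const_add c.2
  refine ⟨((A / (1 + z.1 ^ 2)) • ContinuousLinearMap.fst ℝ ℝ ℝ
      + (0 : ℝ) • ContinuousLinearMap.snd ℝ ℝ ℝ).prod
      ((-(B * z.1 * z.2 / r ^ 3)) • ContinuousLinearMap.fst ℝ ℝ ℝ
      + (B * (1 + z.1 ^ 2) / r ^ 3) • ContinuousLinearMap.snd ℝ ℝ ℝ), ?_, ?_⟩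
  · refine HasFDerivAt.prodMk ?_ ?_
    · refine hu.congr_fderiv ?_
      ext <;> simp
      field_simp
    · refine hv.congr_fderiv ?_
      ext <;> simp [← hrdef]
      · field_simp
      · field_simp
        linear_combination B * hrsq
  · rw [det_prod_fst_snd]
    field_simp
    ring

end Box

open Classical in
/-- The twist map of the plane transported to an open box, extended by the identity. -/
noncomputable def boxTwist (c : ℝ × ℝ) (A B : ℝ) (θ : ℝ → ℝ) (x : ℝ × ℝ) : ℝ × ℝ :=
  if x ∈ openBox c A B then planeToBox c A B (planeTwist θ (boxToPlane c A B x)) else x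

section BoxTwist

variable {c : ℝ × ℝ} {A B : ℝ} {θ : ℝ → ℝ}

lemma boxTwist_of_notMem {x : ℝ × ℝ} (hx : x ∉ openBox c A B) : boxTwist c A B θ x = x :=
  if_neg hx

lemma boxTwist_of_mem {x : ℝ × ℝ} (hx : x ∈ openBox c A B) :
    boxTwist c A B θ x = planeToBox c A B (planeTwist θ (boxToPlane c A B x)) :=
  if_pos hx

lemma boxTwist_mem_iff (hA : 0 < A) (hB : 0 < B) {x : ℝ × ℝ} :
    boxTwist c A B θ x ∈ openBox c A B ↔ x ∈ openBox c A B := by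
  by_cases hx : x ∈ openBox c A B
  · simp [hx, boxTwist_of_mem hx, planeToBox_mem hA hB]
  · rw [boxTwist_of_notMem hx]

lemma boxTwist_mem_iff_of_subset (hA : 0 < A) (hB : 0 < B) {M : Set (ℝ × ℝ)}
    (hM : openBox c A B ⊆ M) {x : ℝ × ℝ} : boxTwist c A B θ x ∈ M ↔ x ∈ M := by
  by_cases hx : x ∈ openBox c A B
  · exact iff_of_true (hM ((boxTwist_mem_iff hA hB).2 hx)) (hM hx)
  · rw [boxTwist_of_notMem hx]

lemma boxTwist_neg_comp (hA : 0 < A) (hB : 0 < B) (x : ℝ × ℝ) :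
    boxTwist c A B (-θ) (boxTwist c A B θ x) = x := by
  by_cases hx : x ∈ openBox c A B
  · rw [boxTwist_of_mem ((boxTwist_mem_iff hA hB).2 hx), boxTwist_of_mem hx,
      boxToPlane_planeToBox hA hB, planeTwist_neg_comp, planeToBox_boxToPlane hA hB hx]
  · rw [boxTwist_of_notMem hx, boxTwist_of_notMem hx]

lemma contDiff_boxTwist (hA : 0 < A) (hB : 0 < B) (hθ : ContDiff ℝ ∞ θ) {R : ℝ}
    (hR : ∀ ρ, R ≤ ρ → θ ρ = 0) : ContDiff ℝ ∞ (boxTwist c A B θ) := by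
  rw [contDiff_iff_contDiffAt]
  intro x
  by_cases hx : x ∈ openBox c A B
  · have hnhds : openBox c A B ∈ 𝓝 x := (isOpen_openBox c A B).mem_nhds hx
    have h1 : ContDiffAt ℝ ∞ (boxToPlane c A B) x := (contDiffOn_boxToPlane hA hB).contDiffAt hnhds
    have h2 := (((contDiff_planeToBox c A B).comp (contDiff_planeTwist hθ)).contDiffAt
      (x := boxToPlane c A B x)).comp x h1
    refine h2.congr_of_eventuallyEq ?_
    filter_upwards [hnhds] with y hy
    exact boxTwist_of_mem hy
  · have hK : IsCompact (planeToBox c A B '' {z : ℝ × ℝ | z.1 ^ 2 + z.2 ^ 2 ≤ R}) := by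
      refine IsCompact.image ?_ (contDiff_planeToBox c A B).continuous
      refine (isCompact_closedBall (0 : ℝ × ℝ) √R).of_isClosed_subset
        (isClosed_le (by fun_prop) continuous_const) ?_
      intro z hz
      rw [mem_ofPred_eq] at hz
      rw [mem_closedBall_zero_iff, Prod.norm_def, sup_le_iff, Real.norm_eq_abs, Real.norm_eq_abs]
      constructor <;> apply Real.abs_le_sqrt <;> nlinarith [sq_nonneg z.1, sq_nonneg z.2]
    have hxK : x ∉ planeToBox c A B '' {z : ℝ × ℝ | z.1 ^ 2 + z.2 ^ 2 ≤ R} := by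
      rintro ⟨z, -, rfl⟩
      exact hx (planeToBox_mem hA hB z)
    refine contDiffAt_id.congr_of_eventuallyEq ?_
    filter_upwards [hK.isClosed.isOpen_compl.mem_nhds hxK] with y hy
    by_cases hyD : y ∈ openBox c A B
    · rw [boxTwist_of_mem hyD, planeTwist_eq_self, planeToBox_boxToPlane hA hB hyD, id]
      refine hR _ (le_of_lt (not_le.1 fun hle => hy ⟨_, hle, planeToBox_boxToPlane hA hB hyD⟩))
    · exact boxTwist_of_notMem hyD

lemma map_planeToBox_planeTwist (hA : 0 < A) (hB : 0 < B) (hθ : Differentiable ℝ θ) :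
    Measure.map (planeToBox c A B ∘ planeTwist θ)
      ((volume : Measure (ℝ × ℝ)).withDensity fun z =>
        ENNReal.ofReal (A * B / √(1 + (z.1 ^ 2 + z.2 ^ 2)) ^ 3))
      = volume.restrict (openBox c A B) := by
  choose T hT hTdet using exists_hasFDerivAt_planeTwist hθ
  choose F hF hFdet using exists_hasFDerivAt_planeToBox c A B
  have hinj : Function.Injective (planeToBox c A B ∘ planeTwist θ) := by
    refine Function.LeftInverse.injective (g := planeTwist (-θ) ∘ boxToPlane c A B) fun z => ?_
    simp [boxToPlane_planeToBox hA hB, planeTwist_neg_comp]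
  have hrange : (planeToBox c A B ∘ planeTwist θ) '' univ = openBox c A B := by
    ext x
    constructor
    · rintro ⟨z, -, rfl⟩
      exact planeToBox_mem hA hB _
    · intro hx
      refine ⟨planeTwist (-θ) (boxToPlane c A B x), trivial, ?_⟩
      have := planeTwist_neg_comp (-θ) (boxToPlane c A B x)
      rw [neg_neg] at this
      rw [Function.comp_apply, this, planeToBox_boxToPlane hA hB hx]
  have key := map_withDensity_abs_det_fderiv_eq_addHaar (volume : Measure (ℝ × ℝ))
    (s := univ) (f := planeToBox c A B ∘ planeTwist θ)
    (f' := fun z => (F (planeTwist θ z)).comp (T z)) nullMeasurableSet_univ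
    (fun z _ => ((hF _).comp z (hT z)).hasFDerivWithinAt) hinj.injOn
  rw [hrange, Measure.restrict_univ] at key
  rw [← key]
  congr 2
  ext z
  have hdet : ((F (planeTwist θ z)).comp (T z)).det = A * B / √(1 + (z.1 ^ 2 + z.2 ^ 2)) ^ 3 := by
    rw [ContinuousLinearMap.det, ContinuousLinearMap.toLinearMap_comp, LinearMap.det_comp]
    have h1 := hFdet (planeTwist θ z)
    have h2 := hTdet z
    rw [ContinuousLinearMap.det] at h1 h2
    rw [h1, h2, planeTwist_normSq, mul_one]
  rw [hdet, abs_of_nonneg (by positivity)]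

lemma measurePreserving_boxTwist (hA : 0 < A) (hB : 0 < B) (hθ : ContDiff ℝ ∞ θ) {R : ℝ}
    (hR : ∀ ρ, R ≤ ρ → θ ρ = 0) :
    MeasurePreserving (boxTwist c A B θ) (volume : Measure (ℝ × ℝ)) volume := by
  have hmeas : Measurable (boxTwist c A B θ) := (contDiff_boxTwist hA hB hθ hR).continuous.measurable
  have hD : MeasurableSet (openBox c A B) := (isOpen_openBox c A B).measurableSet
  have hθd : Differentiable ℝ θ := hθ.differentiable (by simp)
  refine ⟨hmeas, ?_⟩
  have h0 := map_planeToBox_planeTwist (c := c) hA hB (θ := 0) (differentiable_const 0)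
  have hid : planeToBox c A B ∘ planeTwist 0 = planeToBox c A B := by
    ext1 z; simp [planeTwist_eq_self]
  rw [hid] at h0
  have hin : Measure.map (boxTwist c A B θ) (volume.restrict (openBox c A B))
      = volume.restrict (openBox c A B) := by
    conv_lhs => rw [← h0]
    rw [Measure.map_map hmeas (contDiff_planeToBox c A B).continuous.measurable,
      ← map_planeToBox_planeTwist hA hB hθd]
    congr 1
    ext1 z
    simp [boxTwist_of_mem (planeToBox_mem hA hB z), boxToPlane_planeToBox hA hB]
  have hout : Measure.map (boxTwist c A B θ) (volume.restrict (openBox c A B)ᶜ)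
      = volume.restrict (openBox c A B)ᶜ := by
    have : boxTwist c A B θ =ᵐ[volume.restrict (openBox c A B)ᶜ] id :=
      (ae_restrict_mem hD.compl).mono fun x hx => boxTwist_of_notMem hx
    rw [Measure.map_congr this, Measure.map_id]
  conv_lhs => rw [← Measure.restrict_add_restrict_compl (μ := volume) hD]
  rw [Measure.map_add _ _ hmeas, hin, hout, Measure.restrict_add_restrict_compl hD]

lemma isSmoothAPDiffeo_boxTwist (hA : 0 < A) (hB : 0 < B) (hθ : ContDiff ℝ ∞ θ) {R : ℝ}
    (hR : ∀ ρ, R ≤ ρ → θ ρ = 0) {M : Set (ℝ × ℝ)} (hM : MeasurableSet M)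
    (hDM : openBox c A B ⊆ M) : IsSmoothAPDiffeo M (boxTwist c A B θ) := by
  have hl := boxTwist_neg_comp (c := c) (θ := θ) hA hB
  have hr := boxTwist_neg_comp (c := c) (θ := -θ) hA hB
  rw [neg_neg] at hr
  have hMT : boxTwist c A B θ ⁻¹' M = M := Set.ext fun x => boxTwist_mem_iff_of_subset hA hB hDM
  have hn : ContDiff ℝ ∞ (boxTwist c A B (-θ)) :=
    contDiff_boxTwist hA hB hθ.neg (R := R) fun ρ hρ => by simp [hR ρ hρ]
  refine ⟨⟨fun x hx => (boxTwist_mem_iff_of_subset hA hB hDM).2 hx,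
      (Function.LeftInverse.injective hl).injOn, fun x hx => ⟨boxTwist c A B (-θ) x,
      (boxTwist_mem_iff_of_subset hA hB hDM).2 hx, hr x⟩⟩,
    (contDiff_boxTwist hA hB hθ hR).contDiffOn,
    ⟨boxTwist c A B (-θ), hn.contDiffOn, fun x _ => hl x, fun x _ => hr x⟩, ?_⟩
  have := (measurePreserving_boxTwist (c := c) hA hB hθ hR).restrict_preimage hM
  rwa [hMT] at this

end BoxTwist

/-- Area-preserving diffeomorphisms approximate the half-turn of an open box contained in `M`. -/
lemma exists_diffeo_halfTurn {M : Set (ℝ × ℝ)} (hM : MeasurableSet M) (c : ℝ × ℝ) {a b : ℝ}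
    (ha : 0 < a) (hb : 0 < b)
    (hDM : Ioo (c.1 - a) (c.1 + a) ×ˢ Ioo (c.2 - b) (c.2 + b) ⊆ M) {ε : ENNReal} (hε : 0 < ε) :
    ∃ φ, IsSmoothAPDiffeo M φ ∧
      (∀ x ∉ Ioo (c.1 - a) (c.1 + a) ×ˢ Ioo (c.2 - b) (c.2 + b), φ x = x) ∧
      volume {x ∈ Ioo (c.1 - a) (c.1 + a) ×ˢ Ioo (c.2 - b) (c.2 + b) | φ x ≠ c + c - x} ≤ ε := by
  set A := a / (Real.pi / 2) with hAdef
  have hA : 0 < A := by positivity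
  have hbox : Ioo (c.1 - a) (c.1 + a) ×ˢ Ioo (c.2 - b) (c.2 + b) = openBox c A b := by
    rw [openBox, hAdef, div_mul_cancel₀ _ (by positivity)]
  rw [hbox] at hDM ⊢
  have hcont : ContinuousOn (boxToPlane c A b) (openBox c A b) :=
    (contDiffOn_boxToPlane hA hb).continuousOn
  set E : ℕ → Set (ℝ × ℝ) := fun n =>
    openBox c A b ∩ boxToPlane c A b ⁻¹' {z | (n : ℝ) < z.1 ^ 2 + z.2 ^ 2} with hE
  have hEmeas : ∀ n, MeasurableSet (E n) := fun n =>
    (hcont.isOpen_inter_preimage (isOpen_openBox c A b)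
      (isOpen_lt continuous_const (by fun_prop))).measurableSet
  have hEanti : Antitone E := fun m n hmn x hx =>
    ⟨hx.1, (Nat.cast_le.2 hmn : (m : ℝ) ≤ n).trans_lt hx.2⟩
  have hEempty : ⋂ n, E n = ∅ := by
    refine eq_empty_of_forall_notMem fun x hx => ?_
    obtain ⟨n, hn⟩ := exists_nat_gt ((boxToPlane c A b x).1 ^ 2 + (boxToPlane c A b x).2 ^ 2)
    exact lt_asymm hn (mem_iInter.1 hx n).2
  have hfin : volume (E 0) ≠ ⊤ := by
    refine ne_top_of_le_ne_top ?_ (measure_mono inter_subset_left)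
    exact ((Metric.isBounded_Ioo _ _).prod (Metric.isBounded_Ioo _ _)).measure_lt_top.ne
  have hlim := tendsto_measure_iInter_atTop (μ := volume)
    (fun n => (hEmeas n).nullMeasurableSet) hEanti ⟨0, hfin⟩
  rw [hEempty, measure_empty] at hlim
  obtain ⟨n, hn⟩ := (hlim.eventually (gt_mem_nhds hε)).exists
  set θ : ℝ → ℝ := fun t => Real.pi * Real.smoothTransition (n + 1 - t) with hθ
  have hθs : ContDiff ℝ ∞ θ :=
    contDiff_const.mul (Real.smoothTransition.contDiff.comp (contDiff_const.sub contDiff_id))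
  refine ⟨boxTwist c A b θ, isSmoothAPDiffeo_boxTwist hA hb hθs (R := n + 1) ?_ hM hDM,
    fun x hx => boxTwist_of_notMem hx, (measure_mono ?_).trans hn.le⟩
  · intro ρ hρ
    simp [hθ, Real.smoothTransition.zero_of_nonpos (sub_nonpos.2 hρ)]
  · rintro x ⟨hx, hne⟩
    refine ⟨hx, by_contra fun hlt => hne ?_⟩
    have hle' : (boxToPlane c A b x).1 ^ 2 + (boxToPlane c A b x).2 ^ 2 ≤ n := not_lt.1 hlt
    rw [boxTwist_of_mem hx, planeTwist_eq_neg]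
    · have h1 := planeToBox_boxToPlane hA hb hx
      have h2 : ∀ z, planeToBox c A b (-z) = c + c - planeToBox c A b z := by
        intro z
        ext <;> simp [planeToBox, Real.arctan_neg] <;> ring
      rw [h2, h1]
    · have hle1 : (1 : ℝ) ≤
          n + 1 - ((boxToPlane c A b x).1 ^ 2 + (boxToPlane c A b x).2 ^ 2) := by linarith
      simp only [hθ, Real.smoothTransition.one_of_one_le hle1, mul_one]

end SmoothTwist

/-- The half-open square of side `s` with lower left corner `s • k`. -/
def gridCell (s : ℝ) (k : ℤ × ℤ) : Set (ℝ × ℝ) :=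
  Ico (s * k.1) (s * k.1 + s) ×ˢ Ico (s * k.2) (s * k.2 + s)

/-- The index of the grid square of side `s` containing a point. -/
noncomputable def gridIndex (s : ℝ) (x : ℝ × ℝ) : ℤ × ℤ := (⌊x.1 / s⌋, ⌊x.2 / s⌋)

lemma mem_gridCell {s : ℝ} {k : ℤ × ℤ} {x : ℝ × ℝ} : x ∈ gridCell s k ↔
    (s * k.1 ≤ x.1 ∧ x.1 < s * k.1 + s) ∧ (s * k.2 ≤ x.2 ∧ x.2 < s * k.2 + s) := Iff.rfl

lemma mem_gridCell_iff {s : ℝ} (hs : 0 < s) {k : ℤ × ℤ} {x : ℝ × ℝ} :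
    x ∈ gridCell s k ↔ gridIndex s x = k := by
  rw [mem_gridCell, gridIndex, Prod.ext_iff, Int.floor_eq_iff, Int.floor_eq_iff, le_div_iff₀ hs,
    le_div_iff₀ hs, div_lt_iff₀ hs, div_lt_iff₀ hs]
  constructor <;> rintro ⟨⟨h1, h2⟩, h3, h4⟩ <;> refine ⟨⟨?_, ?_⟩, ?_, ?_⟩ <;> linarith

lemma measurableSet_gridCell (s : ℝ) (k : ℤ × ℤ) : MeasurableSet (gridCell s k) :=
  measurableSet_Ico.prod measurableSet_Ico

lemma volume_gridCell {s : ℝ} (hs : 0 < s) (k : ℤ × ℤ) :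
    volume (gridCell s k) = ENNReal.ofReal (s ^ 2) := by
  rw [gridCell, Measure.volume_eq_prod, Measure.prod_prod, Real.volume_Ico, Real.volume_Ico,
    add_sub_cancel_left, add_sub_cancel_left, ← ENNReal.ofReal_mul hs.le, sq]

/-- The permutations of the grid squares of side `s` which can be approximated in measure by
area-preserving diffeomorphisms of `M`. -/
def approxPerm (M : Set (ℝ × ℝ)) (s : ℝ) : Submonoid (Equiv.Perm (ℤ × ℤ)) where
  carrier := {σ | ∀ ε : ENNReal, 0 < ε → ∃ φ, IsSmoothAPDiffeo M φ ∧
    ∀ k, volume.restrict M (gridCell s k \ φ ⁻¹' gridCell s (σ k)) ≤ ε}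
  one_mem' := fun ε _ => ⟨id, IsSmoothAPDiffeo.id M, fun k => by simp⟩
  mul_mem' := by
    intro σ τ hσ hτ ε hε
    obtain ⟨φ, hφ, hφk⟩ := hσ (ε / 2) (ENNReal.half_pos hε.ne')
    obtain ⟨χ, hχ, hχk⟩ := hτ (ε / 2) (ENNReal.half_pos hε.ne')
    refine ⟨φ ∘ χ, hφ.comp hχ, fun k => ?_⟩
    calc volume.restrict M (gridCell s k \ (φ ∘ χ) ⁻¹' gridCell s ((σ * τ) k))
        ≤ volume.restrict M ((gridCell s k \ χ ⁻¹' gridCell s (τ k)) ∪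
            χ ⁻¹' (gridCell s (τ k) \ φ ⁻¹' gridCell s (σ (τ k)))) := by
          refine measure_mono fun x hx => ?_
          by_cases h : χ x ∈ gridCell s (τ k)
          · exact Or.inr ⟨h, hx.2⟩
          · exact Or.inl ⟨hx.1, h⟩
      _ ≤ ε / 2 + ε / 2 := by
          refine (measure_union_le _ _).trans (add_le_add (hχk k) ?_)
          refine (hχ.2.2.2.measure_preimage_le _).trans (hφk _)
      _ = ε := ENNReal.add_halves ε

lemma volume_axisParallel_eq_zero (a a' b b' : ℝ) :
    volume {x : ℝ × ℝ | (x.1 = a ∨ x.1 = a') ∨ (x.2 = b ∨ x.2 = b')} = 0 := by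
  have h : {x : ℝ × ℝ | (x.1 = a ∨ x.1 = a') ∨ (x.2 = b ∨ x.2 = b')}
      = (({a, a'} : Set ℝ) ×ˢ univ) ∪ (univ ×ˢ ({b, b'} : Set ℝ)) := by
    ext x; simp
  rw [h, measure_union_null_iff, Measure.volume_eq_prod, Measure.prod_prod, Measure.prod_prod]
  simp [((Set.toFinite ({a, a'} : Set ℝ)).measure_zero volume),
    ((Set.toFinite ({b, b'} : Set ℝ)).measure_zero volume)]

/-- If a half-turn of a box exchanges two grid squares up to a null set, then their transposition
is approximable. -/
lemma swap_mem_approxPerm_of_halfTurn {M : Set (ℝ × ℝ)} (hM : MeasurableSet M) {s : ℝ}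
    (hs : 0 < s) {k l : ℤ × ℤ} (c : ℝ × ℝ) {a b : ℝ} (ha : 0 < a) (hb : 0 < b) (N : Set (ℝ × ℝ))
    (hN : volume N = 0) (hkM : gridCell s k ⊆ M) (hlM : gridCell s l ⊆ M)
    (hD : Ioo (c.1 - a) (c.1 + a) ×ˢ Ioo (c.2 - b) (c.2 + b) ⊆ gridCell s k ∪ gridCell s l)
    (hk : ∀ x ∈ gridCell s k, x ∉ N →
      x ∈ Ioo (c.1 - a) (c.1 + a) ×ˢ Ioo (c.2 - b) (c.2 + b) ∧ c + c - x ∈ gridCell s l)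
    (hl : ∀ x ∈ gridCell s l, x ∉ N →
      x ∈ Ioo (c.1 - a) (c.1 + a) ×ˢ Ioo (c.2 - b) (c.2 + b) ∧ c + c - x ∈ gridCell s k) :
    Equiv.swap k l ∈ approxPerm M s := by
  intro ε hε
  obtain ⟨φ, hφ, hid, hturn⟩ := exists_diffeo_halfTurn hM c ha hb
    (hD.trans (union_subset hkM hlM)) hε
  have key : ∀ i j, (∀ x ∈ gridCell s i, x ∉ N →
      x ∈ Ioo (c.1 - a) (c.1 + a) ×ˢ Ioo (c.2 - b) (c.2 + b) ∧ c + c - x ∈ gridCell s j) →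
      volume.restrict M (gridCell s i \ φ ⁻¹' gridCell s j) ≤ ε := by
    intro i j hij
    refine (Measure.restrict_apply_le _ _).trans ?_
    refine (measure_mono (t := N ∪ {x | x ∈ Ioo (c.1 - a) (c.1 + a) ×ˢ
      Ioo (c.2 - b) (c.2 + b) ∧ φ x ≠ c + c - x}) ?_).trans
      ((measure_union_le N _).trans (by rw [hN, zero_add]; exact hturn))
    rintro x ⟨hx, hxj⟩
    by_cases hxN : x ∈ N
    · exact Or.inl hxN
    · refine Or.inr ⟨(hij x hx hxN).1, fun h => hxj ?_⟩
      rw [mem_preimage, h]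
      exact (hij x hx hxN).2
  refine ⟨φ, hφ, fun j => ?_⟩
  by_cases hjk : j = k
  · subst hjk
    rw [Equiv.swap_apply_left]
    exact key _ _ hk
  by_cases hjl : j = l
  · subst hjl
    rw [Equiv.swap_apply_right]
    exact key _ _ hl
  rw [Equiv.swap_apply_of_ne_of_ne hjk hjl]
  have hempty : gridCell s j \ φ ⁻¹' gridCell s j = ∅ := by
    refine eq_empty_of_forall_notMem ?_
    rintro x ⟨hx, hxj⟩
    have hxD : x ∉ Ioo (c.1 - a) (c.1 + a) ×ˢ Ioo (c.2 - b) (c.2 + b) := by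
      intro h
      rw [mem_gridCell_iff hs] at hx
      rcases hD h with h | h <;> rw [mem_gridCell_iff hs] at h
      · exact hjk (hx.symm.trans h)
      · exact hjl (hx.symm.trans h)
    exact hxj (by rwa [mem_preimage, hid x hxD])
  simp [hempty]

lemma swap_right_mem_approxPerm {M : Set (ℝ × ℝ)} (hM : MeasurableSet M) {s : ℝ} (hs : 0 < s)
    (i j : ℤ) (hk : gridCell s (i, j) ⊆ M) (hl : gridCell s (i + 1, j) ⊆ M) :
    Equiv.swap (i, j) (i + 1, j) ∈ approxPerm M s := by
  refine swap_mem_approxPerm_of_halfTurn hM hs (s * i + s, s * j + s / 2) hs (half_pos hs)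
    _ (volume_axisParallel_eq_zero (s * i) (s * i + s) (s * j) (s * j)) hk hl ?_ ?_ ?_
  · rintro x ⟨⟨h1, h2⟩, h3, h4⟩
    simp only [mem_union, mem_gridCell, Int.cast_add, Int.cast_one] at *
    rcases lt_or_ge x.1 (s * i + s) with h | h
    · left; refine ⟨⟨?_, ?_⟩, ?_, ?_⟩ <;> linarith
    · right; refine ⟨⟨?_, ?_⟩, ?_, ?_⟩ <;> linarith
  all_goals
    intro x hx hxN
    simp only [mem_gridCell, mem_ofPred_eq, not_or, or_self, mem_prod, mem_Ioo, Prod.fst_add,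
      Prod.snd_add, Prod.fst_sub, Prod.snd_sub, Int.cast_add, Int.cast_one, mul_add, mul_one,
      ← ne_eq] at *
    obtain ⟨⟨h1, h2⟩, h3, h4⟩ := hx
    obtain ⟨⟨n1, n2⟩, n3⟩ := hxN
    refine ⟨⟨⟨?_, ?_⟩, ?_, ?_⟩, ⟨?_, ?_⟩, ?_, ?_⟩ <;>
    first
    | linarith
    | linarith [lt_of_le_of_ne h1 n1.symm]
    | linarith [lt_of_le_of_ne h1 n2.symm]
    | linarith [lt_of_le_of_ne h3 n3.symm]

lemma swap_up_mem_approxPerm {M : Set (ℝ × ℝ)} (hM : MeasurableSet M) {s : ℝ} (hs : 0 < s)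
    (i j : ℤ) (hk : gridCell s (i, j) ⊆ M) (hl : gridCell s (i, j + 1) ⊆ M) :
    Equiv.swap (i, j) (i, j + 1) ∈ approxPerm M s := by
  refine swap_mem_approxPerm_of_halfTurn hM hs (s * i + s / 2, s * j + s) (half_pos hs) hs
    _ (volume_axisParallel_eq_zero (s * i) (s * i) (s * j) (s * j + s)) hk hl ?_ ?_ ?_
  · rintro x ⟨⟨h1, h2⟩, h3, h4⟩
    simp only [mem_union, mem_gridCell, Int.cast_add, Int.cast_one] at *
    rcases lt_or_ge x.2 (s * j + s) with h | h
    · left; refine ⟨⟨?_, ?_⟩, ?_, ?_⟩ <;> linarith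
    · right; refine ⟨⟨?_, ?_⟩, ?_, ?_⟩ <;> linarith
  all_goals
    intro x hx hxN
    simp only [mem_gridCell, mem_ofPred_eq, not_or, or_self, mem_prod, mem_Ioo, Prod.fst_add,
      Prod.snd_add, Prod.fst_sub, Prod.snd_sub, Int.cast_add, Int.cast_one, mul_add, mul_one,
      ← ne_eq] at *
    obtain ⟨⟨h1, h2⟩, h3, h4⟩ := hx
    obtain ⟨n3, n1, n2⟩ := hxN
    refine ⟨⟨⟨?_, ?_⟩, ?_, ?_⟩, ⟨?_, ?_⟩, ?_, ?_⟩ <;>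
    first
    | linarith
    | linarith [lt_of_le_of_ne h3 n1.symm]
    | linarith [lt_of_le_of_ne h3 n2.symm]
    | linarith [lt_of_le_of_ne h1 n3.symm]

lemma Submonoid.swap_mem_trans {α : Type*} [DecidableEq α] {S : Submonoid (Equiv.Perm α)}
    {x y z : α} (hxy : Equiv.swap x y ∈ S) (hyz : Equiv.swap y z ∈ S) : Equiv.swap x z ∈ S := by
  by_cases h1 : x = y
  · subst h1; exact hyz
  by_cases h2 : x = z
  · subst h2; rw [Equiv.swap_self]; exact S.one_mem
  rw [Equiv.swap_comm x z, ← Equiv.swap_mul_swap_mul_swap h1 h2]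
  exact S.mul_mem (S.mul_mem hyz hxy) hyz

lemma reflTransGen_swap_mem {α : Type*} [DecidableEq α] {S : Submonoid (Equiv.Perm α)} (f : ℤ → α)
    {m n : ℤ} (h : ∀ i, i ∈ uIcc m n → i + 1 ∈ uIcc m n → Equiv.swap (f i) (f (i + 1)) ∈ S) :
    Equiv.swap (f m) (f n) ∈ S := by
  have hgen : Relation.ReflTransGen (fun i j => Equiv.swap (f i) (f j) ∈ S) m n := by
    refine reflTransGen_of_succ _ (fun i hi => ?_) (fun i hi => ?_)
    · refine h i ?_ ?_ <;> rw [mem_uIcc] <;> have := hi.1 <;> have := hi.2 <;> omega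
    · rw [Equiv.swap_comm]
      refine h i ?_ ?_ <;> rw [mem_uIcc] <;> have := hi.1 <;> have := hi.2 <;> omega
  clear h
  induction hgen with
  | refl => rw [Equiv.swap_self]; exact S.one_mem
  | tail _ hlast ih => exact Submonoid.swap_mem_trans ih hlast

lemma abs_sub_lt_of_mem_uIcc_floor {x y x₀ z s δ : ℝ} (hs : 0 < s) (hsδ : s ≤ δ)
    (hx : |x - x₀| < δ) (hy : |y - x₀| < δ) {i : ℤ} (hi : i ∈ uIcc ⌊x / s⌋ ⌊y / s⌋)
    (h1 : s * i ≤ z) (h2 : z < s * i + s) : |z - x₀| < 2 * δ := by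
  rw [abs_lt] at *
  have hfloor : ∀ w : ℝ, s * ⌊w / s⌋ ≤ w ∧ w < s * ⌊w / s⌋ + s := by
    intro w
    have hlo := Int.floor_le (w / s)
    have hhi := Int.lt_floor_add_one (w / s)
    rw [le_div_iff₀ hs] at hlo
    rw [div_lt_iff₀ hs] at hhi
    constructor <;> linarith
  have hmono : ∀ {a b : ℤ}, a ≤ b → s * (a : ℝ) ≤ s * (b : ℝ) := fun h =>
    mul_le_mul_of_nonneg_left (by exact_mod_cast h) hs.le
  have hfx := hfloor x
  have hfy := hfloor y
  rcases mem_uIcc.1 hi with ⟨hxi, hiy⟩ | ⟨hyi, hix⟩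
  · have := hmono hxi
    have := hmono hiy
    constructor <;> linarith
  · have := hmono hyi
    have := hmono hix
    constructor <;> linarith

/-- Two nearby points lie in grid squares whose transposition is approximable. -/
lemma swap_gridIndex_mem_approxPerm_of_ball {M : Set (ℝ × ℝ)} (hM : MeasurableSet M)
    {x₀ x y : ℝ × ℝ} {δ s : ℝ} (hball : Metric.ball x₀ (2 * δ) ⊆ M) (hx : x ∈ Metric.ball x₀ δ)
    (hy : y ∈ Metric.ball x₀ δ) (hs : 0 < s) (hsδ : s ≤ δ) :
    Equiv.swap (gridIndex s x) (gridIndex s y) ∈ approxPerm M s ∧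
      gridCell s (gridIndex s x) ⊆ M := by
  rw [Metric.mem_ball, Prod.dist_eq, max_lt_iff, Real.dist_eq, Real.dist_eq] at hx hy
  have hcell : ∀ i ∈ uIcc ⌊x.1 / s⌋ ⌊y.1 / s⌋, ∀ j ∈ uIcc ⌊x.2 / s⌋ ⌊y.2 / s⌋,
      gridCell s (i, j) ⊆ M := by
    intro i hi j hj z hz
    refine hball ?_
    rw [Metric.mem_ball, Prod.dist_eq, max_lt_iff, Real.dist_eq, Real.dist_eq]
    exact ⟨abs_sub_lt_of_mem_uIcc_floor hs hsδ hx.1 hy.1 hi hz.1.1 hz.1.2,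
      abs_sub_lt_of_mem_uIcc_floor hs hsδ hx.2 hy.2 hj hz.2.1 hz.2.2⟩
  refine ⟨?_, hcell _ left_mem_uIcc _ left_mem_uIcc⟩
  refine Submonoid.swap_mem_trans (y := (⌊y.1 / s⌋, ⌊x.2 / s⌋)) ?_ ?_
  · exact reflTransGen_swap_mem (fun i => (i, ⌊x.2 / s⌋)) fun i hi hi' =>
      swap_right_mem_approxPerm hM hs _ _ (hcell _ hi _ left_mem_uIcc)
        (hcell _ hi' _ left_mem_uIcc)
  · exact reflTransGen_swap_mem (fun j => (⌊y.1 / s⌋, j)) fun j hj hj' =>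
      swap_up_mem_approxPerm hM hs _ _ (hcell _ right_mem_uIcc _ hj)
        (hcell _ right_mem_uIcc _ hj')

/-- The local version of the connectedness of the grid, uniform near a point. -/
lemma exists_mem_nhds_forall_swap_mem_approxPerm {M : Set (ℝ × ℝ)} (hM : IsOpen M)
    {x₀ : ℝ × ℝ} (hx₀ : x₀ ∈ M) : ∃ U ∈ 𝓝 x₀, ∀ᶠ s in 𝓝[>] (0 : ℝ), ∀ x ∈ U, ∀ y ∈ U,
      Equiv.swap (gridIndex s x) (gridIndex s y) ∈ approxPerm M s ∧
        gridCell s (gridIndex s x) ⊆ M := by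
  obtain ⟨r, hr, hball⟩ := Metric.isOpen_iff.1 hM x₀ hx₀
  refine ⟨Metric.ball x₀ (r / 2), Metric.ball_mem_nhds _ (half_pos hr), ?_⟩
  filter_upwards [Ioc_mem_nhdsGT (half_pos hr)] with s hs x hx y hy
  exact swap_gridIndex_mem_approxPerm_of_ball hM.measurableSet
    (by rwa [mul_div_cancel₀ r two_ne_zero]) hx hy hs.1 hs.2

lemma eventually_swap_gridIndex_mem_approxPerm {M : Set (ℝ × ℝ)} (hM : IsOpen M)
    (hconn : IsPreconnected M) {x y : ℝ × ℝ} (hx : x ∈ M) (hy : y ∈ M) :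
    ∀ᶠ s in 𝓝[>] (0 : ℝ), Equiv.swap (gridIndex s x) (gridIndex s y) ∈ approxPerm M s := by
  refine hconn.induction₂ (fun x y => ∀ᶠ s in 𝓝[>] (0 : ℝ),
    Equiv.swap (gridIndex s x) (gridIndex s y) ∈ approxPerm M s) ?_ ?_ ?_ hx hy
  · intro x hx
    obtain ⟨U, hU, h⟩ := exists_mem_nhds_forall_swap_mem_approxPerm hM hx
    filter_upwards [mem_nhdsWithin_of_mem_nhds hU] with y hy
    filter_upwards [h] with s hs
    exact (hs x (mem_of_mem_nhds hU) y hy).1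
  · intro x y z _ _ _ hxy hyz
    filter_upwards [hxy, hyz] with s h1 h2
    exact Submonoid.swap_mem_trans h1 h2
  · intro x y _ _ hxy
    filter_upwards [hxy] with s h
    rwa [Equiv.swap_comm]

/-- On a fine enough grid, the squares meeting a given compact subset of a connected open set
are contained in that set and all their transpositions are approximable. -/
lemma eventually_forall_swap_mem_approxPerm {M K : Set (ℝ × ℝ)} (hM : IsOpen M)
    (hconn : IsConnected M) (hK : IsCompact K) (hKM : K ⊆ M) :
    ∀ᶠ s in 𝓝[>] (0 : ℝ), ∀ x ∈ K, ∀ y ∈ K,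
      Equiv.swap (gridIndex s x) (gridIndex s y) ∈ approxPerm M s ∧
        gridCell s (gridIndex s x) ⊆ M := by
  obtain ⟨b, hb⟩ := hconn.nonempty
  have key : ∀ᶠ s in 𝓝[>] (0 : ℝ), ∀ x ∈ K,
      Equiv.swap (gridIndex s b) (gridIndex s x) ∈ approxPerm M s ∧
        gridCell s (gridIndex s x) ⊆ M := by
    refine hK.induction_on (p := fun K => ∀ᶠ s in 𝓝[>] (0 : ℝ), ∀ x ∈ K,
      Equiv.swap (gridIndex s b) (gridIndex s x) ∈ approxPerm M s ∧
        gridCell s (gridIndex s x) ⊆ M) (by simp) ?_ ?_ ?_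
    · intro K K' hKK' h
      filter_upwards [h] with s hs x hx using hs x (hKK' hx)
    · intro K K' h h'
      filter_upwards [h, h'] with s hs hs' x hx
      exact hx.elim (hs x) (hs' x)
    · intro x hx
      obtain ⟨U, hU, h⟩ := exists_mem_nhds_forall_swap_mem_approxPerm hM (hKM hx)
      refine ⟨U, mem_nhdsWithin_of_mem_nhds hU, ?_⟩
      filter_upwards [h, eventually_swap_gridIndex_mem_approxPerm hM hconn.isPreconnected hb
        (hKM hx)] with s hs hbx y hy
      exact ⟨Submonoid.swap_mem_trans hbx (hs x (mem_of_mem_nhds hU) y hy).1, (hs y hy x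
        (mem_of_mem_nhds hU)).2⟩
  filter_upwards [key] with s hs x hx y hy
  refine ⟨Submonoid.swap_mem_trans ?_ (hs y hy).1, (hs x hx).2⟩
  rw [Equiv.swap_comm]
  exact (hs x hx).1

/-- A submonoid containing all the transpositions of elements of a finite set contains all the
permutations supported in this set. -/
lemma Submonoid.ofSubtype_mem_of_swap_mem {α : Type*} [DecidableEq α]
    {S : Submonoid (Equiv.Perm α)} (t : Finset α)
    (h : ∀ x ∈ t, ∀ y ∈ t, Equiv.swap x y ∈ S) (σ : Equiv.Perm t) :
    Equiv.Perm.ofSubtype σ ∈ S := by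
  induction σ using Equiv.Perm.swap_induction_on with
  | one => rw [map_one]; exact S.one_mem
  | swap_mul f x y _ ih =>
    rw [map_mul, Equiv.Perm.ofSubtype_swap_eq]
    exact S.mul_mem (h x x.2 y y.2) ih

/-- Two injections from a type into a finite type differ by a permutation of the target. -/
lemma exists_perm_apply_eq {ι E : Type*} [Finite ι] (e f : E ↪ ι) :
    ∃ σ : Equiv.Perm ι, ∀ x, σ (e x) = f x := by
  classical
  have := Fintype.ofFinite ι
  let g : {x // x ∈ range e} ≃ {x // x ∈ range f} :=
    (Equiv.ofInjective e e.injective).symm.trans (Equiv.ofInjective f f.injective)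
  refine ⟨g.extendSubtype, fun x => ?_⟩
  rw [Equiv.extendSubtype_apply_of_mem g _ (mem_range_self x)]
  have : (⟨e x, mem_range_self x⟩ : {x // x ∈ range e}) = Equiv.ofInjective e e.injective x := rfl
  rw [this]
  simp [g]

lemma exists_embedding_of_sum_le {ι P : Type*} [Fintype ι] [Fintype P] [DecidableEq P] (c : ι → P)
    (n : P → P → ℕ) (h : ∀ p, ∑ q, n p q ≤ (Finset.univ.filter fun k => c k = p).card) :
    ∃ e : (Σ p, Σ q, Fin (n p q)) ↪ ι, ∀ x, c (e x) = x.1 := by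
  have hp : ∀ p, Nonempty ((Σ q, Fin (n p q)) ↪ {k // c k = p}) := by
    intro p
    refine Function.Embedding.nonempty_of_card_le ?_
    rw [Fintype.card_sigma, Fintype.card_subtype]
    simpa using h p
  have f := fun p => (hp p).some
  refine ⟨⟨fun x => (f x.1 x.2 : ι), ?_⟩, fun x => (f x.1 x.2).2⟩
  rintro ⟨p, x⟩ ⟨p', x'⟩ hxx'
  have hpp' : p = p' := (f p x).2.symm.trans ((congrArg c hxx').trans (f p' x').2)
  subst hpp'
  exact congrArg (Sigma.mk p) ((f p).injective (Subtype.ext hxx'))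

/-- A permutation of a finite coloured set realizing prescribed numbers of colour changes. -/
lemma exists_perm_le_card_filter {ι P : Type*} [Fintype ι] [Fintype P] [DecidableEq P]
    (c : ι → P) (n : P → P → ℕ)
    (h₁ : ∀ p, ∑ q, n p q ≤ (Finset.univ.filter fun k => c k = p).card)
    (h₂ : ∀ q, ∑ p, n p q ≤ (Finset.univ.filter fun k => c k = q).card) :
    ∃ σ : Equiv.Perm ι,
      ∀ p q, n p q ≤ (Finset.univ.filter fun k => c k = p ∧ c (σ k) = q).card := by
  classical
  obtain ⟨e, he⟩ := exists_embedding_of_sum_le c n h₁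
  obtain ⟨f, hf⟩ := exists_embedding_of_sum_le c (fun q p => n p q) h₂
  let g : (Σ p, Σ q, Fin (n p q)) ↪ (Σ q, Σ p, Fin (n p q)) :=
    ⟨fun x => ⟨x.2.1, x.1, x.2.2⟩, by
      rintro ⟨p, q, i⟩ ⟨p', q', i'⟩ h
      simp only [Sigma.mk.injEq] at h
      obtain ⟨rfl, h⟩ := h
      simp only [heq_eq_eq, Sigma.mk.injEq] at h
      obtain ⟨rfl, h⟩ := h
      simp only [heq_eq_eq] at h
      rw [h]⟩
  obtain ⟨σ, hσ⟩ := exists_perm_apply_eq e (g.trans f)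
  refine ⟨σ, fun p q => ?_⟩
  have hinj : Function.Injective fun i : Fin (n p q) => e ⟨p, q, i⟩ := by
    intro i j hij
    simpa using e.injective hij
  calc n p q = (Finset.univ.image fun i : Fin (n p q) => e ⟨p, q, i⟩).card := by
        rw [Finset.card_image_of_injective _ hinj, Finset.card_univ, Fintype.card_fin]
    _ ≤ _ := by
        refine Finset.card_le_card fun k hk => ?_
        simp only [Finset.mem_image, Finset.mem_univ, true_and] at hk
        obtain ⟨i, rfl⟩ := hk
        simp only [Finset.mem_filter, Finset.mem_univ, true_and]
        exact ⟨he _, by rw [hσ]; exact hf _⟩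

lemma ENNReal.exists_nat_mul_le_and_le {a v : ENNReal} (ha : a ≠ ⊤) (hv : v ≠ 0) (hv' : v ≠ ⊤) :
    ∃ n : ℕ, n * v ≤ a ∧ a ≤ (n + 1) * v := by
  have hav : a / v ≠ ⊤ := ENNReal.div_ne_top ha hv
  refine ⟨⌊(a / v).toReal⌋₊, ?_, ?_⟩
  · rw [← ENNReal.le_div_iff_mul_le (Or.inl hv) (Or.inl hv'), ← ENNReal.ofReal_toReal hav,
      ← ENNReal.ofReal_natCast]
    refine ENNReal.ofReal_le_ofReal ?_
    rw [ENNReal.ofReal_toReal hav]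
    exact Nat.floor_le ENNReal.toReal_nonneg
  · rw [← ENNReal.div_le_iff hv hv', ← ENNReal.ofReal_toReal hav, ← ENNReal.ofReal_natCast,
      ← ENNReal.ofReal_one, ← ENNReal.ofReal_add (Nat.cast_nonneg _) zero_le_one]
    refine ENNReal.ofReal_le_ofReal ?_
    rw [ENNReal.ofReal_toReal hav]
    exact (Nat.lt_floor_add_one _).le

/-- Given finitely many disjoint sets of the same measure `v`, grouped into colours, any coupling
is, up to an error of `v` per pair of colours, dominated on unions of products of colour classes
by a permutation of the sets. -/
lemma exists_perm_measure_iUnion_prod_le {X ι P : Type*} [MeasurableSpace X] [Fintype ι]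
    [Fintype P] [DecidableEq P] {μ : Measure X} {π : Measure (X × X)} [IsFiniteMeasure π]
    (hfst : π.map Prod.fst = μ) (hsnd : π.map Prod.snd = μ) {R : ι → Set X}
    (hR : ∀ k, MeasurableSet (R k)) (hdisj : Pairwise fun k l => Disjoint (R k) (R l))
    {v : ENNReal} (hv : v ≠ 0) (hv' : v ≠ ⊤) (hRv : ∀ k, μ (R k) = v) (c : ι → P) :
    ∃ σ : Equiv.Perm ι, ∀ T : Finset (P × P),
      π (⋃ k, ⋃ l, ⋃ (_ : (c k, c l) ∈ T), R k ×ˢ R l) ≤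
        (Fintype.card P ^ 2 : ℕ) * v +
          (Finset.univ.filter fun k => (c k, c (σ k)) ∈ T).card * v := by
  classical
  set Q : P → Set X := fun p => ⋃ k ∈ Finset.univ.filter fun k => c k = p, R k with hQ
  have hQm : ∀ p, MeasurableSet (Q p) := fun p =>
    Finset.measurableSet_biUnion _ fun k _ => hR k
  have hQd : ∀ p q, p ≠ q → Disjoint (Q p) (Q q) := by
    intro p q hpq
    simp only [hQ, disjoint_iUnion_left, disjoint_iUnion_right, Finset.mem_filter,
      Finset.mem_univ, true_and]
    intro k hk l hl
    exact hdisj fun hkl => hpq (by rw [← hl, ← hk, hkl])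
  have hQμ : ∀ p, μ (Q p) ≤ (Finset.univ.filter fun k => c k = p).card * v := by
    intro p
    refine (measure_biUnion_finset_le _ _).trans ?_
    simp [hRv]
  have hn := fun p q => ENNReal.exists_nat_mul_le_and_le (measure_ne_top π (Q p ×ˢ Q q)) hv hv'
  choose n hn₁ hn₂ using hn
  have hcancel : ∀ {a b : ℕ}, (a : ENNReal) * v ≤ b * v → a ≤ b := by
    intro a b hab
    exact_mod_cast (ENNReal.mul_le_mul_iff_left hv hv').1 hab
  have hrow : ∀ p, ∑ q, n p q ≤ (Finset.univ.filter fun k => c k = p).card := by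
    refine fun p => hcancel ?_
    calc ((∑ q, n p q : ℕ) : ENNReal) * v = ∑ q, n p q * v := by
          rw [Nat.cast_sum, Finset.sum_mul]
      _ ≤ ∑ q, π (Q p ×ˢ Q q) := Finset.sum_le_sum fun q _ => hn₁ p q
      _ = π (⋃ q ∈ Finset.univ, Q p ×ˢ Q q) := by
          rw [measure_biUnion_finset]
          · intro q _ q' _ h
            exact Disjoint.set_prod_right (hQd q q' h) _ _
          · exact fun q _ => (hQm p).prod (hQm q)
      _ ≤ π (Prod.fst ⁻¹' Q p) :=
          measure_mono (iUnion₂_subset fun q _ x hx => hx.1)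
      _ = μ (Q p) := by rw [← hfst, Measure.map_apply measurable_fst (hQm p)]
      _ ≤ _ := hQμ p
  have hcol : ∀ q, ∑ p, n p q ≤ (Finset.univ.filter fun k => c k = q).card := by
    refine fun q => hcancel ?_
    calc ((∑ p, n p q : ℕ) : ENNReal) * v = ∑ p, n p q * v := by
          rw [Nat.cast_sum, Finset.sum_mul]
      _ ≤ ∑ p, π (Q p ×ˢ Q q) := Finset.sum_le_sum fun p _ => hn₁ p q
      _ = π (⋃ p ∈ Finset.univ, Q p ×ˢ Q q) := by
          rw [measure_biUnion_finset]
          · intro p _ p' _ h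
            exact Disjoint.set_prod_left (hQd p p' h) _ _
          · exact fun p _ => (hQm p).prod (hQm q)
      _ ≤ π (Prod.snd ⁻¹' Q q) :=
          measure_mono (iUnion₂_subset fun p _ x hx => hx.2)
      _ = μ (Q q) := by rw [← hsnd, Measure.map_apply measurable_snd (hQm q)]
      _ ≤ _ := hQμ q
  obtain ⟨σ, hσ⟩ := exists_perm_le_card_filter c n hrow hcol
  refine ⟨σ, fun T => ?_⟩
  have hcard : (∑ t ∈ T, n t.1 t.2) ≤
      (Finset.univ.filter fun k => (c k, c (σ k)) ∈ T).card := by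
    rw [Finset.card_eq_sum_card_fiberwise (f := fun k => (c k, c (σ k))) (t := T)]
    · refine Finset.sum_le_sum fun t ht => (hσ t.1 t.2).trans (Finset.card_le_card ?_)
      intro k hk
      simp only [Finset.mem_filter, Finset.mem_univ, true_and] at hk ⊢
      have : (c k, c (σ k)) = t := Prod.ext hk.1 hk.2
      exact ⟨this ▸ ht, this⟩
    · intro k hk
      simpa using hk
  calc π (⋃ k, ⋃ l, ⋃ (_ : (c k, c l) ∈ T), R k ×ˢ R l)
      ≤ π (⋃ t ∈ T, Q t.1 ×ˢ Q t.2) := by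
        refine measure_mono ?_
        refine iUnion_subset fun k => iUnion_subset fun l => iUnion_subset fun hkl => ?_
        rintro ⟨x, y⟩ ⟨hx, hy⟩
        simp only [hQ, mem_iUnion, mem_prod, Finset.mem_filter, Finset.mem_univ, true_and]
        exact ⟨(c k, c l), hkl, ⟨k, rfl, hx⟩, ⟨l, rfl, hy⟩⟩
    _ ≤ ∑ t ∈ T, π (Q t.1 ×ˢ Q t.2) := measure_biUnion_finset_le _ _
    _ ≤ ∑ t ∈ T, ((n t.1 t.2 : ENNReal) + 1) * v := Finset.sum_le_sum fun t _ => hn₂ _ _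
    _ = T.card * v + (∑ t ∈ T, n t.1 t.2 : ℕ) * v := by
        rw [← Finset.sum_mul, Finset.sum_add_distrib, Finset.sum_const, nsmul_one, Nat.cast_sum,
          add_comm, add_mul]
    _ ≤ _ := by
        gcongr
        rw [sq, ← Fintype.card_prod]
        exact Finset.card_le_univ T

lemma dist_lt_of_mem_gridCell {s : ℝ} {k : ℤ × ℤ} {x y : ℝ × ℝ} (hx : x ∈ gridCell s k)
    (hy : y ∈ gridCell s k) : dist x y < s := by
  rw [mem_gridCell] at hx hy
  rw [Prod.dist_eq, max_lt_iff, Real.dist_eq, Real.dist_eq, abs_lt, abs_lt]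
  refine ⟨⟨?_, ?_⟩, ?_, ?_⟩ <;> linarith

lemma finite_image_gridIndex {K : Set (ℝ × ℝ)} (hK : Bornology.IsBounded K) {s : ℝ}
    (hs : 0 < s) : (gridIndex s '' K).Finite := by
  obtain ⟨R, hR⟩ := hK.subset_closedBall 0
  refine ((finite_Icc ⌊-R / s⌋ ⌊R / s⌋).prod (finite_Icc ⌊-R / s⌋ ⌊R / s⌋)).subset ?_
  rintro _ ⟨x, hx, rfl⟩
  have hxR := hR hx
  rw [mem_closedBall_zero_iff, Prod.norm_def, max_le_iff, Real.norm_eq_abs, Real.norm_eq_abs,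
    abs_le, abs_le] at hxR
  exact ⟨⟨Int.floor_mono (by gcongr; exact hxR.1.1), Int.floor_mono (by gcongr; exact hxR.1.2)⟩,
    Int.floor_mono (by gcongr; exact hxR.2.1), Int.floor_mono (by gcongr; exact hxR.2.2)⟩

/-- If a diffeomorphism almost realizes a permutation of the grid squares, then the squares
selected by a set `B` of indices are almost filled by the points following the permutation. -/
lemma card_mul_le_measure_of_approx {M : Set (ℝ × ℝ)} {s : ℝ} (hs : 0 < s)
    {φ : ℝ × ℝ → ℝ × ℝ} (hφ : Measurable φ) (τ : ℤ × ℤ → ℤ × ℤ) {δ : ENNReal}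
    (h : ∀ k, volume.restrict M (gridCell s k \ φ ⁻¹' gridCell s (τ k)) ≤ δ)
    (B : Finset (ℤ × ℤ)) (hB : ∀ k ∈ B, gridCell s k ⊆ M) :
    B.card * ENNReal.ofReal (s ^ 2) ≤
      volume.restrict M (⋃ k ∈ B, gridCell s k ∩ φ ⁻¹' gridCell s (τ k)) + B.card * δ := by
  have hcell : ∀ k ∈ B, ENNReal.ofReal (s ^ 2) ≤
      volume.restrict M (gridCell s k ∩ φ ⁻¹' gridCell s (τ k)) + δ := by
    intro k hk
    rw [← volume_gridCell hs k, ← Measure.restrict_eq_self volume (hB k hk),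
      ← measure_inter_add_sdiff (gridCell s k) (hφ (measurableSet_gridCell s (τ k)))]
    gcongr
    exact h k
  rw [measure_biUnion_finset]
  · calc (B.card : ENNReal) * ENNReal.ofReal (s ^ 2) = ∑ k ∈ B, ENNReal.ofReal (s ^ 2) := by simp
      _ ≤ ∑ k ∈ B, (volume.restrict M (gridCell s k ∩ φ ⁻¹' gridCell s (τ k)) + δ) :=
        Finset.sum_le_sum hcell
      _ = _ := by rw [Finset.sum_add_distrib]; simp
  · intro k _ l _ hkl
    refine disjoint_left.2 fun x hx hx' => hkl ?_
    rw [← (mem_gridCell_iff hs).1 hx.1, ← (mem_gridCell_iff hs).1 hx'.1]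
  · exact fun k _ => (measurableSet_gridCell s k).inter (hφ (measurableSet_gridCell s (τ k)))

/-- Every coupling of Lebesgue measure on a bounded connected open set with itself is close, in
the Lévy–Prokhorov sense, to the graph of an area-preserving diffeomorphism. -/
lemma exists_diffeo_coupling_le {M : Set (ℝ × ℝ)} (hMopen : IsOpen M) (hMconn : IsConnected M)
    (hMbdd : Bornology.IsBounded M) {π : Measure ((ℝ × ℝ) × (ℝ × ℝ))}
    (hfst : π.map Prod.fst = volume.restrict M) (hsnd : π.map Prod.snd = volume.restrict M)
    {ε : ℝ} (hε : 0 < ε) :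
    ∃ φ, IsSmoothAPDiffeo M φ ∧ ∀ A : Set ((ℝ × ℝ) × (ℝ × ℝ)),
      π A ≤ volume.restrict M {x | (x, φ x) ∈ Metric.thickening ε A} + ENNReal.ofReal ε := by
  classical
  have hMfin : volume M ≠ ⊤ := hMbdd.measure_lt_top.ne
  have : IsFiniteMeasure π := by
    refine ⟨?_⟩
    have h := congrArg (fun ν => ν univ) hfst
    simp only [Measure.map_apply measurable_fst MeasurableSet.univ, preimage_univ,
      Measure.restrict_apply_univ] at h
    rw [h]
    exact hMfin.lt_top
  set η : ENNReal := ENNReal.ofReal (ε / 4) with hη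
  have hη0 : 0 < η := ENNReal.ofReal_pos.2 (by positivity)
  obtain ⟨K, hKM, hK, hKη⟩ :=
    hMopen.measurableSet.exists_isCompact_sdiff_lt hMfin hη0.ne'
  set r : ℝ := ε / 4 with hr
  have hr0 : 0 < r := by positivity
  obtain ⟨t, -, htfin, htK⟩ := hK.finite_cover_balls hr0
  have := htfin.fintype
  have hsmall : ∀ᶠ s in 𝓝[>] (0 : ℝ),
      (Fintype.card t ^ 2 : ℕ) * ENNReal.ofReal (s ^ 2) ≤ η := by
    have hcont : Tendsto (fun s : ℝ => ((Fintype.card t ^ 2 : ℕ) : ENNReal) *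
        ENNReal.ofReal (s ^ 2)) (𝓝 0) (𝓝 0) := by
      have h := (ENNReal.continuous_const_mul (ENNReal.natCast_ne_top (Fintype.card t ^ 2))).comp
        (ENNReal.continuous_ofReal.comp (continuous_pow (M := ℝ) 2))
      simpa [Function.comp_def] using h.tendsto 0
    exact (hcont.mono_left nhdsWithin_le_nhds).eventually (Iic_mem_nhds hη0)
  obtain ⟨s, hsperm, hsη, hs0, hsr⟩ :=
    ((eventually_forall_swap_mem_approxPerm hMopen hMconn hK hKM).and
      (hsmall.and (Ioc_mem_nhdsGT hr0))).exists
  set I : Finset (ℤ × ℤ) := (finite_image_gridIndex hK.isBounded hs0).toFinset with hI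
  have hmemI : ∀ k, k ∈ I ↔ ∃ x ∈ K, gridIndex s x = k := by
    intro k; simp [hI]
  have hIM : ∀ k ∈ I, gridCell s k ⊆ M := by
    intro k hk
    obtain ⟨x, hx, rfl⟩ := (hmemI k).1 hk
    exact (hsperm x hx x hx).2
  have hcol : ∀ k : I, ∃ p : t, ∀ z ∈ gridCell s k, dist z p < 2 * r := by
    rintro ⟨k, hk⟩
    obtain ⟨x, hx, hxk⟩ := (hmemI k).1 hk
    obtain ⟨p, hp, hxp⟩ := mem_iUnion₂.1 (htK hx)
    refine ⟨⟨p, hp⟩, fun z hz => ?_⟩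
    have h1 := dist_lt_of_mem_gridCell hz ((mem_gridCell_iff hs0).2 hxk)
    have h2 := dist_triangle z x p
    rw [Metric.mem_ball] at hxp
    change dist z p < 2 * r
    linarith
  choose c hc using hcol
  have hv0 : ENNReal.ofReal (s ^ 2) ≠ 0 := (ENNReal.ofReal_pos.2 (by positivity)).ne'
  obtain ⟨σ, hσ⟩ := exists_perm_measure_iUnion_prod_le hfst hsnd
    (R := fun k : I => gridCell s k) (fun k => measurableSet_gridCell s k)
    (fun k l hkl => disjoint_left.2 fun x hx hx' => hkl (Subtype.ext
      (((mem_gridCell_iff hs0).1 hx).symm.trans ((mem_gridCell_iff hs0).1 hx'))))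
    hv0 ENNReal.ofReal_ne_top
    (fun k => by rw [Measure.restrict_eq_self volume (hIM k k.2), volume_gridCell hs0]) c
  have hτ : Equiv.Perm.ofSubtype σ ∈ approxPerm M s := by
    refine Submonoid.ofSubtype_mem_of_swap_mem I (fun k hk l hl => ?_) σ
    obtain ⟨x, hx, rfl⟩ := (hmemI k).1 hk
    obtain ⟨y, hy, rfl⟩ := (hmemI l).1 hl
    exact (hsperm x hx y hy).1
  obtain ⟨φ, hφ, hφk⟩ := hτ (η / (I.card + 1))
    (ENNReal.div_pos hη0.ne' (ENNReal.add_ne_top.2 ⟨ENNReal.natCast_ne_top _, ENNReal.one_ne_top⟩))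
  refine ⟨φ, hφ, fun A => ?_⟩
  set T : Finset (t × t) := Finset.univ.filter fun pq =>
    ∃ k l : I, c k = pq.1 ∧ c l = pq.2 ∧ (gridCell s k ×ˢ gridCell s l ∩ A).Nonempty with hT
  set B : Finset I := Finset.univ.filter fun k => (c k, c (σ k)) ∈ T with hB
  have hKc : volume.restrict M Kᶜ ≤ η := by
    rw [Measure.restrict_apply hK.measurableSet.compl, inter_comm, ← sdiff_eq]
    exact hKη.le
  have hfstK : π (Prod.fst ⁻¹' Kᶜ) ≤ η := by
    rwa [← Measure.map_apply measurable_fst hK.measurableSet.compl, hfst]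
  have hsndK : π (Prod.snd ⁻¹' Kᶜ) ≤ η := by
    rwa [← Measure.map_apply measurable_snd hK.measurableSet.compl, hsnd]
  have hcover : A ⊆ Prod.fst ⁻¹' Kᶜ ∪ Prod.snd ⁻¹' Kᶜ ∪
      ⋃ k : I, ⋃ l : I, ⋃ (_ : (c k, c l) ∈ T), gridCell s k ×ˢ gridCell s l := by
    rintro ⟨x, y⟩ hxy
    by_cases hx : x ∈ K
    · by_cases hy : y ∈ K
      · refine Or.inr ?_
        have hmem : (x, y) ∈ gridCell s (gridIndex s x) ×ˢ gridCell s (gridIndex s y) :=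
          ⟨(mem_gridCell_iff hs0).2 rfl, (mem_gridCell_iff hs0).2 rfl⟩
        refine mem_iUnion.2 ⟨⟨gridIndex s x, (hmemI _).2 ⟨x, hx, rfl⟩⟩, mem_iUnion.2
          ⟨⟨gridIndex s y, (hmemI _).2 ⟨y, hy, rfl⟩⟩, mem_iUnion.2 ⟨?_, hmem⟩⟩⟩
        rw [hT, Finset.mem_filter]
        exact ⟨Finset.mem_univ _, _, _, rfl, rfl, (x, y), hmem, hxy⟩
      · exact Or.inl (Or.inr hy)
    · exact Or.inl (Or.inl hx)
  have hfill : (B.card : ENNReal) * ENNReal.ofReal (s ^ 2) ≤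
      volume.restrict M {x | (x, φ x) ∈ Metric.thickening ε A} + η := by
    have h := card_mul_le_measure_of_approx hs0 hφ.2.2.2.measurable
      (Equiv.Perm.ofSubtype σ) hφk (B.map (Function.Embedding.subtype _)) (by
        intro k hk
        obtain ⟨k, -, rfl⟩ := Finset.mem_map.1 hk
        exact hIM k k.2)
    rw [Finset.card_map] at h
    refine h.trans (add_le_add (measure_mono ?_) ?_)
    · refine iUnion₂_subset fun k hk => ?_
      obtain ⟨k, hkB, rfl⟩ := Finset.mem_map.1 hk
      rintro x ⟨hx, hφx⟩
      rw [mem_preimage, Function.Embedding.subtype_apply, Equiv.Perm.ofSubtype_apply_coe] at hφx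
      have hkT := (Finset.mem_filter.1 hkB).2
      obtain ⟨-, k', l', hk', hl', ⟨a, b⟩, ⟨ha, hb⟩, habA⟩ := Finset.mem_filter.1 hkT
      refine Metric.mem_thickening_iff.2 ⟨(a, b), habA, ?_⟩
      have h1 := hc k x hx
      have h2 := hc (σ k) (φ x) hφx
      have h3 := hc k' a ha
      have h4 := hc l' b hb
      rw [hk'] at h3
      rw [hl'] at h4
      rw [Prod.dist_eq, max_lt_iff]
      have h5 := dist_triangle_right x a (c k)
      have h6 := dist_triangle_right (φ x) b (c (σ k))
      constructor
      · change dist x a < ε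
        linarith
      · change dist (φ x) b < ε
        linarith
    · calc (B.card : ENNReal) * (η / (I.card + 1)) ≤ (I.card + 1) * (η / (I.card + 1)) := by
            gcongr
            have hBI : B.card ≤ I.card := by
              simpa using Finset.card_le_univ B
            calc (B.card : ENNReal) ≤ I.card := by exact_mod_cast hBI
              _ ≤ I.card + 1 := le_self_add
        _ = η := ENNReal.mul_div_cancel (by simp) (by simp)
  calc π A ≤ π (Prod.fst ⁻¹' Kᶜ) + π (Prod.snd ⁻¹' Kᶜ) +
        π (⋃ k : I, ⋃ l : I, ⋃ (_ : (c k, c l) ∈ T), gridCell s k ×ˢ gridCell s l) :=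
        (measure_mono hcover).trans ((measure_union_le _ _).trans
          (by gcongr; exact measure_union_le _ _))
    _ ≤ η + η + (η + (volume.restrict M {x | (x, φ x) ∈ Metric.thickening ε A} + η)) := by
        refine add_le_add (add_le_add hfstK hsndK) ((hσ T).trans (add_le_add hsη hfill))
    _ = volume.restrict M {x | (x, φ x) ∈ Metric.thickening ε A} + ENNReal.ofReal ε := by
        have h4 : ENNReal.ofReal ε = η + η + (η + η) := by
          rw [hη, ← ENNReal.ofReal_add (by positivity) (by positivity),
            ← ENNReal.ofReal_add (by positivity) (by positivity)]
          congr 1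
          ring
        rw [h4]
        ring

/-- One-sided Lévy–Prokhorov estimates imply weak convergence. -/
lemma ProbabilityMeasure.tendsto_of_forall_le_thickening {X : Type*} [PseudoMetricSpace X]
    [MeasurableSpace X] [OpensMeasurableSpace X] {P : ProbabilityMeasure X}
    {Q : ℕ → ProbabilityMeasure X} {ε : ℕ → ℝ} {δ : ℕ → ENNReal} (hε : Tendsto ε atTop (𝓝 0))
    (hδ : Tendsto δ atTop (𝓝 0))
    (h : ∀ n A, (P : Measure X) A ≤ (Q n : Measure X) (Metric.thickening (ε n) A) + δ n) :
    Tendsto Q atTop (𝓝 P) := by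
  refine tendsto_of_forall_isOpen_le_liminf_nat' fun G hG => ?_
  set A : ℕ → Set X := fun k => {z | Metric.ball z (1 / (k + 1)) ⊆ G} with hA
  have hmono : Monotone A := fun k l hkl z (hz : _ ⊆ G) =>
    show _ ⊆ G from (Metric.ball_subset_ball (one_div_le_one_div_of_le (by positivity)
      (by gcongr))).trans hz
  have hunion : ⋃ k, A k = G := by
    refine Subset.antisymm (iUnion_subset fun k z (hz : _ ⊆ G) =>
      hz (Metric.mem_ball_self (by positivity))) fun z hz => ?_
    obtain ⟨r, hr, hzr⟩ := Metric.isOpen_iff.1 hG z hz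
    obtain ⟨k, hk⟩ := exists_nat_one_div_lt hr
    exact mem_iUnion.2 ⟨k, show _ ⊆ G from (Metric.ball_subset_ball hk.le).trans hzr⟩
  rw [← hunion]
  refine le_of_tendsto' (tendsto_measure_iUnion_atTop hmono) fun k => ?_
  rw [hunion, ← ENNReal.liminf_add_of_right_tendsto_zero hδ]
  refine le_liminf_of_le (by isBoundedDefault) ?_
  filter_upwards [hε.eventually (Iio_mem_nhds (show (0 : ℝ) < 1 / (k + 1) by positivity))]
    with n hn
  refine (h n (A k)).trans (add_le_add_left (measure_mono fun z hz => ?_) _)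
  obtain ⟨a, ha, haz⟩ := Metric.mem_thickening_iff.1 hz
  exact (show _ ⊆ G from ha) (Metric.mem_ball.2 (haz.trans hn))

lemma tendsto_integral_of_forall_le_thickening {X : Type*} [PseudoMetricSpace X]
    [MeasurableSpace X] [OpensMeasurableSpace X] {ν : Measure X} {ρ : ℕ → Measure X}
    {m : ENNReal} (hm : m ≠ 0) (hm' : m ≠ ⊤) (hν : ν univ = m) (hρ : ∀ n, ρ n univ = m)
    {ε : ℕ → ℝ} {δ : ℕ → ENNReal} (hε : Tendsto ε atTop (𝓝 0)) (hδ : Tendsto δ atTop (𝓝 0))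
    (h : ∀ n A, ν A ≤ ρ n (Metric.thickening (ε n) A) + δ n) (f : X →ᵇ ℝ) :
    Tendsto (fun n => ∫ x, f x ∂(ρ n)) atTop (𝓝 (∫ x, f x ∂ν)) := by
  have hprob : ∀ {τ : Measure X}, τ univ = m → IsProbabilityMeasure (m⁻¹ • τ) := fun hτ =>
    ⟨by rw [Measure.smul_apply, hτ, smul_eq_mul, ENNReal.inv_mul_cancel hm hm']⟩
  let normalized : ∀ τ : Measure X, τ univ = m → ProbabilityMeasure X := fun τ hτ =>
    ⟨m⁻¹ • τ, hprob hτ⟩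
  have hlim : Tendsto (fun n => normalized (ρ n) (hρ n)) atTop (𝓝 (normalized ν hν)) := by
    refine ProbabilityMeasure.tendsto_of_forall_le_thickening hε (δ := fun n => m⁻¹ * δ n) ?_ ?_
    · simpa using ENNReal.Tendsto.const_mul hδ (Or.inr (ENNReal.inv_ne_top.2 hm))
    · intro n A
      change m⁻¹ * ν A ≤ m⁻¹ * ρ n _ + m⁻¹ * δ n
      rw [← mul_add]
      gcongr
      exact h n A
  have hintegral := (ProbabilityMeasure.tendsto_iff_forall_integral_tendsto.1 hlim f).const_mul m.toReal
  have hscale : ∀ τ : Measure X, m.toReal * ∫ x, f x ∂(m⁻¹ • τ) = ∫ x, f x ∂τ := by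
    intro τ
    rw [integral_smul_measure, smul_eq_mul, ← mul_assoc, ENNReal.toReal_inv,
      mul_inv_cancel₀ (ENNReal.toReal_ne_zero.2 ⟨hm, hm'⟩), one_mul]
  simpa only [normalized, ProbabilityMeasure.coe_mk, hscale] using hintegral

section Coupling

variable {X : Type*} [MeasurableSpace X] {μ : Measure X}

lemma integrable_mul_of_coupling {ρ : Measure (X × X)} (h₁ : MeasurePreserving Prod.fst ρ μ)
    (h₂ : MeasurePreserving Prod.snd ρ μ) {g f : X → ℝ} (hg : Integrable g μ)
    (hf : MemLp f ⊤ μ) : Integrable (fun z => g z.1 * f z.2) ρ :=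
  (h₁.integrable_comp_of_integrable hg).mul_of_top_left (hf.comp_measurePreserving h₂)

lemma abs_integral_mul_sub_le_of_coupling {ρ : Measure (X × X)}
    (h₁ : MeasurePreserving Prod.fst ρ μ) (h₂ : MeasurePreserving Prod.snd ρ μ)
    {g f g' f' : X → ℝ} (hg : Integrable g μ) (hf : MemLp f ⊤ μ) (hg' : Integrable g' μ)
    (hf' : MemLp f' ⊤ μ) (hff' : Integrable (fun x => f x - f' x) μ) {C D : ℝ}
    (hC : ∀ᵐ x ∂μ, ‖f x‖ ≤ C) (hD : ∀ x, ‖g' x‖ ≤ D) :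
    |(∫ z, g z.1 * f z.2 ∂ρ) - ∫ z, g' z.1 * f' z.2 ∂ρ| ≤
      C * (∫ x, ‖g x - g' x‖ ∂μ) + D * ∫ x, ‖f x - f' x‖ ∂μ := by
  have hi₁ : Integrable (fun z : X × X => ‖g z.1 - g' z.1‖) ρ :=
    (h₁.integrable_comp_of_integrable (hg.sub hg')).norm
  have hi₂ : Integrable (fun z : X × X => ‖f z.2 - f' z.2‖) ρ :=
    (h₂.integrable_comp_of_integrable hff').norm
  rw [← integral_sub (integrable_mul_of_coupling h₁ h₂ hg hf)
    (integrable_mul_of_coupling h₁ h₂ hg' hf'), ← Real.norm_eq_abs]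
  have e₁ : ∫ x, ‖g x - g' x‖ ∂μ = ∫ z, ‖g z.1 - g' z.1‖ ∂ρ := by
    rw [← h₁.map_eq, integral_map h₁.measurable.aemeasurable]
    rw [h₁.map_eq]
    exact (hg.sub hg').norm.aestronglyMeasurable
  have e₂ : ∫ x, ‖f x - f' x‖ ∂μ = ∫ z, ‖f z.2 - f' z.2‖ ∂ρ := by
    rw [← h₂.map_eq, integral_map h₂.measurable.aemeasurable]
    rw [h₂.map_eq]
    exact hff'.norm.aestronglyMeasurable
  rw [e₁, e₂, ← integral_const_mul, ← integral_const_mul,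
    ← integral_add (hi₁.const_mul C) (hi₂.const_mul D)]
  refine norm_integral_le_of_norm_le ((hi₁.const_mul C).add (hi₂.const_mul D)) ?_
  filter_upwards [h₂.quasiMeasurePreserving.ae hC] with z hz
  calc ‖g z.1 * f z.2 - g' z.1 * f' z.2‖
      = ‖f z.2 * (g z.1 - g' z.1) + g' z.1 * (f z.2 - f' z.2)‖ := by ring_nf
    _ ≤ ‖f z.2‖ * ‖g z.1 - g' z.1‖ + ‖g' z.1‖ * ‖f z.2 - f' z.2‖ := by
        refine (norm_add_le _ _).trans ?_
        rw [norm_mul, norm_mul]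
    _ ≤ C * ‖g z.1 - g' z.1‖ + D * ‖f z.2 - f' z.2‖ := by
        gcongr
        exact hD z.1

/-- Weak convergence of couplings of a fixed measure implies convergence of the integrals of
products of an integrable function and a bounded function. -/
lemma tendsto_integral_mul_of_coupling [TopologicalSpace X] [NormalSpace X] [BorelSpace X]
    [IsFiniteMeasure μ] [μ.WeaklyRegular] {ι : Type*} {l : Filter ι}
    {ρ : ι → Measure (X × X)} {π : Measure (X × X)}
    (h₁ : ∀ i, MeasurePreserving Prod.fst (ρ i) μ) (h₂ : ∀ i, MeasurePreserving Prod.snd (ρ i) μ)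
    (hπ₁ : MeasurePreserving Prod.fst π μ) (hπ₂ : MeasurePreserving Prod.snd π μ)
    (hlim : ∀ h : (X × X) →ᵇ ℝ, Tendsto (fun i => ∫ z, h z ∂(ρ i)) l (𝓝 (∫ z, h z ∂π)))
    {g f : X → ℝ} (hg : Integrable g μ) (hf : MemLp f ⊤ μ) :
    Tendsto (fun i => ∫ z, g z.1 * f z.2 ∂(ρ i)) l (𝓝 (∫ z, g z.1 * f z.2 ∂π)) := by
  obtain ⟨C, hC0, hC⟩ : ∃ C : ℝ, 0 < C ∧ ∀ᵐ x ∂μ, ‖f x‖ ≤ C := by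
    refine ⟨(eLpNormEssSup f μ).toReal + 1, by positivity, ?_⟩
    have htop : eLpNormEssSup f μ ≠ ⊤ := by simpa using hf.2.ne
    filter_upwards [ae_le_eLpNormEssSup (f := f) (μ := μ)] with x hx
    have hx' := ENNReal.toReal_mono htop hx
    rw [toReal_enorm] at hx'
    linarith
  rw [Metric.tendsto_nhds]
  intro ε hε
  obtain ⟨g', hgg', hg'⟩ := hg.exists_boundedContinuous_integral_sub_le
    (show 0 < ε / 8 / C by positivity)
  have hD0 : 0 < ‖g'‖ + 1 := by positivity
  have hfi : Integrable f μ := hf.integrable le_top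
  obtain ⟨f', hff', hf'⟩ := hfi.exists_boundedContinuous_integral_sub_le
    (show 0 < ε / 8 / (‖g'‖ + 1) by positivity)
  have hf'top : MemLp f' ⊤ μ := memLp_top_of_bound hf'.aestronglyMeasurable ‖f'‖
    (Eventually.of_forall f'.norm_coe_le_norm)
  have hclose : ∀ {τ : Measure (X × X)}, MeasurePreserving Prod.fst τ μ →
      MeasurePreserving Prod.snd τ μ →
      |(∫ z, g z.1 * f z.2 ∂τ) - ∫ z, g' z.1 * f' z.2 ∂τ| ≤ ε / 4 := by
    intro τ hτ₁ hτ₂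
    refine (abs_integral_mul_sub_le_of_coupling hτ₁ hτ₂ hg hf hg' hf'top (hfi.sub hf') hC
      (D := ‖g'‖ + 1) fun x => (g'.norm_coe_le_norm x).trans (by linarith)).trans ?_
    rw [le_div_iff₀ hC0] at hgg'
    rw [le_div_iff₀ hD0] at hff'
    linarith
  have hcont := hlim ((g'.compContinuous ⟨Prod.fst, continuous_fst⟩) *
    (f'.compContinuous ⟨Prod.snd, continuous_snd⟩))
  filter_upwards [Metric.tendsto_nhds.1 hcont (ε / 4) (by positivity)] with i hi
  have hi₁ := hclose (h₁ i) (h₂ i)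
  have hi₂ := hclose hπ₁ hπ₂
  rw [Real.dist_eq] at hi ⊢
  simp only [BoundedContinuousFunction.coe_mul, Pi.mul_apply,
    BoundedContinuousFunction.compContinuous_apply, ContinuousMap.coe_mk] at hi
  rw [abs_le] at hi₁ hi₂
  rw [abs_lt] at hi ⊢
  constructor <;> linarith

end Coupling

section Bistochastic

variable {X : Type*} [MeasurableSpace X] {μ : Measure X} {κ : Kernel X X}

lemma isBistochastic_iff_compProd [SFinite μ] [IsMarkovKernel κ] :
    IsBistochastic μ κ ↔ (μ ⊗ₘ κ).snd = μ := by
  have key : ∀ A, MeasurableSet A → (μ ⊗ₘ κ).snd A = ∫⁻ x, κ x A ∂μ := by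
    intro A hA
    rw [Measure.snd_compProd, Measure.bind_apply hA κ.aemeasurable]
  refine ⟨fun h => Measure.ext fun A hA => (key A hA).trans (h.2 A hA), fun h =>
    ⟨inferInstance, fun A hA => ?_⟩⟩
  rw [← key A hA, h]

lemma measurePreserving_fst_compProd [SFinite μ] [IsMarkovKernel κ] :
    MeasurePreserving Prod.fst (μ ⊗ₘ κ) μ :=
  ⟨measurable_fst, Measure.fst_compProd μ κ⟩

lemma IsBistochastic.measurePreserving_snd [SFinite μ] (h : IsBistochastic μ κ) :
    MeasurePreserving Prod.snd (μ ⊗ₘ κ) μ :=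
  have := h.1
  ⟨measurable_snd, isBistochastic_iff_compProd.1 h⟩

/-- The pairing of `g` with `Kf` is the integral of `g ⊗ f` against the coupling of `K`. -/
lemma IsBistochastic.integral_mul_kernApply [SFinite μ] (h : IsBistochastic μ κ) {g f : X → ℝ}
    (hg : Integrable g μ) (hf : MemLp f ⊤ μ) :
    ∫ x, g x * kernApply κ f x ∂μ = ∫ z, g z.1 * f z.2 ∂(μ ⊗ₘ κ) := by
  have := h.1
  rw [Measure.integral_compProd (integrable_mul_of_coupling measurePreserving_fst_compProd
    h.measurePreserving_snd hg hf)]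
  simp only [integral_const_mul, kernApply]

lemma IsBistochastic.integrable_kernApply [IsFiniteMeasure μ] (h : IsBistochastic μ κ)
    {f : X → ℝ} (hf : MemLp f ⊤ μ) : Integrable (kernApply κ f) μ := by
  have := h.1
  exact (h.measurePreserving_snd.integrable_comp_of_integrable
    (hf.integrable le_top)).integral_compProd

end Bistochastic

section Graph

variable {X : Type*} [MeasurableSpace X] {μ : Measure X} {φ : X → X}

lemma measurePreserving_fst_graph (hφ : MeasurePreserving φ μ μ) :
    MeasurePreserving Prod.fst (μ.map fun x => (x, φ x)) μ := by
  refine ⟨measurable_fst, ?_⟩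
  rw [Measure.map_map measurable_fst (show Measurable fun x => (x, φ x) from
    measurable_id.prodMk hφ.measurable)]
  exact Measure.map_id

lemma measurePreserving_snd_graph (hφ : MeasurePreserving φ μ μ) :
    MeasurePreserving Prod.snd (μ.map fun x => (x, φ x)) μ := by
  refine ⟨measurable_snd, ?_⟩
  rw [Measure.map_map measurable_snd (show Measurable fun x => (x, φ x) from
    measurable_id.prodMk hφ.measurable)]
  exact hφ.map_eq

lemma integral_mul_graph (hφ : MeasurePreserving φ μ μ) {g f : X → ℝ} (hg : Integrable g μ)
    (hf : MemLp f ⊤ μ) :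
    ∫ z, g z.1 * f z.2 ∂(μ.map fun x => (x, φ x)) = ∫ x, g x * f (φ x) ∂μ :=
  integral_map (measurable_id.prodMk hφ.measurable).aemeasurable
    (integrable_mul_of_coupling (measurePreserving_fst_graph hφ) (measurePreserving_snd_graph hφ)
      hg hf).aestronglyMeasurable

end Graph

/-- Couplings of a finite measure carried by a compact set with itself have weak cluster points
among such couplings. -/
lemma exists_coupling_tendsto {X : Type*} [MetricSpace X] [SecondCountableTopology X]
    [MeasurableSpace X] [BorelSpace X] {μ : Measure X} [IsFiniteMeasure μ] {K : Set X}
    (hK : IsCompact K) (hμK : μ Kᶜ = 0) {ι : Type*} (U : Ultrafilter ι) {ρ : ι → Measure (X × X)}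
    (h₁ : ∀ i, MeasurePreserving Prod.fst (ρ i) μ)
    (h₂ : ∀ i, MeasurePreserving Prod.snd (ρ i) μ) :
    ∃ π : Measure (X × X), MeasurePreserving Prod.fst π μ ∧ MeasurePreserving Prod.snd π μ ∧
      ∀ h : (X × X) →ᵇ ℝ, Tendsto (fun i => ∫ z, h z ∂(ρ i)) U (𝓝 (∫ z, h z ∂π)) := by
  have hmass : ∀ i, ρ i univ = μ univ := fun i => by
    rw [← (h₁ i).measure_preimage MeasurableSet.univ.nullMeasurableSet, preimage_univ]
  have hfin : ∀ i, IsFiniteMeasure (ρ i) := fun i => ⟨by rw [hmass]; exact measure_lt_top μ _⟩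
  let F : ι → FiniteMeasure (X × X) := fun i => ⟨ρ i, hfin i⟩
  let m : FiniteMeasure X := ⟨μ, inferInstance⟩
  have hFmem : ∀ i, F i ∈ {ν : FiniteMeasure (X × X) | ν.mass ≤ m.mass ∧ ν (K ×ˢ K)ᶜ = 0} := by
    intro i
    refine ⟨?_, ?_⟩
    · rw [← ENNReal.coe_le_coe, FiniteMeasure.ennreal_mass, FiniteMeasure.ennreal_mass]
      exact (hmass i).le
    · rw [FiniteMeasure.null_iff_toMeasure_null]
      change ρ i (K ×ˢ K)ᶜ = 0
      rw [compl_prod_eq_union, measure_union_null_iff, prod_univ, univ_prod,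
        (h₁ i).measure_preimage hK.measurableSet.compl.nullMeasurableSet,
        (h₂ i).measure_preimage hK.measurableSet.compl.nullMeasurableSet]
      exact ⟨hμK, hμK⟩
  obtain ⟨π, -, hπ⟩ := (isCompact_setOfPred_finiteMeasure_le_of_isCompact m.mass
    (hK.prod hK)).ultrafilter_le_nhds' (U.map F) (Ultrafilter.mem_map.2
      (Filter.mem_of_superset Filter.univ_mem fun i _ => hFmem i))
  have hlim : Tendsto F U (𝓝 π) := hπ
  have hmarg : ∀ {p : X × X → X}, Continuous p → (∀ i, (ρ i).map p = μ) →
      (π : Measure (X × X)).map p = μ := by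
    intro p hp hρ
    have h := FiniteMeasure.tendsto_map_of_tendsto_of_continuous F π hlim hp
    have hconst : (fun i => (F i).map p) = fun _ => m :=
      funext fun i => Subtype.ext (hρ i)
    rw [hconst] at h
    exact congrArg (fun ν : FiniteMeasure X => (ν : Measure X))
      (tendsto_nhds_unique h tendsto_const_nhds)
  exact ⟨π, ⟨measurable_fst, hmarg continuous_fst fun i => (h₁ i).map_eq⟩,
    ⟨measurable_snd, hmarg continuous_snd fun i => (h₂ i).map_eq⟩,
    FiniteMeasure.tendsto_iff_forall_integral_tendsto.1 hlim⟩

/-- Every coupling of a measure with itself comes from a bistochastic kernel. -/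
lemma exists_isBistochastic_compProd_eq {X : Type*} [MeasurableSpace X] [StandardBorelSpace X]
    [Nonempty X] {μ : Measure X} [IsFiniteMeasure μ] {π : Measure (X × X)}
    (h₁ : MeasurePreserving Prod.fst π μ) (h₂ : MeasurePreserving Prod.snd π μ) :
    ∃ κ : Kernel X X, IsBistochastic μ κ ∧ μ ⊗ₘ κ = π := by
  have : IsFiniteMeasure π := ⟨by
    rw [← preimage_univ (f := Prod.fst), h₁.measure_preimage MeasurableSet.univ.nullMeasurableSet]
    exact measure_lt_top μ _⟩
  have hπ : μ ⊗ₘ π.condKernel = π := by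
    have h := π.disintegrate π.condKernel
    rwa [Measure.fst, h₁.map_eq] at h
  refine ⟨π.condKernel, isBistochastic_iff_compProd.2 ?_, hπ⟩
  rw [hπ]
  exact h₂.map_eq

/-- `ω` is a weak-* limit of rearrangements `ω₀ ∘ φ_n` along
area-preserving smooth diffeomorphisms iff `ω = Kω₀` for some bistochastic kernel. -/
theorem weakStarClosure_eq_bistochastic
    (M : Set (ℝ × ℝ)) (hMopen : IsOpen M) (hMconn : IsConnected M)
    (hMbdd : Bornology.IsBounded M) (hMsm : HasSmoothBoundary M)
    (ω₀ ω : ℝ × ℝ → ℝ)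
    (hω₀ : MemLp ω₀ ⊤ (volume.restrict M)) (hω : MemLp ω ⊤ (volume.restrict M)) :
    (∃ φ : ℕ → ℝ × ℝ → ℝ × ℝ, (∀ n, IsSmoothAPDiffeo M (φ n)) ∧
      ∀ g : ℝ × ℝ → ℝ, Integrable g (volume.restrict M) →
        Filter.Tendsto (fun n => ∫ x, g x * ω₀ (φ n x) ∂(volume.restrict M))
          Filter.atTop (nhds (∫ x, g x * ω x ∂(volume.restrict M)))) ↔
    (∃ κ : Kernel (ℝ × ℝ) (ℝ × ℝ), IsBistochastic (volume.restrict M) κ ∧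
      ω =ᵐ[volume.restrict M] kernApply κ ω₀) := by
  have hMfin : volume M ≠ ⊤ := hMbdd.measure_lt_top.ne
  have hM0 : volume M ≠ 0 := (hMopen.measure_pos volume hMconn.nonempty).ne'
  have : IsFiniteMeasure (volume.restrict M) := ⟨by simpa using hMfin.lt_top⟩
  set μ : Measure (ℝ × ℝ) := volume.restrict M with hμ
  constructor
  · rintro ⟨φ, hφ, hlim⟩
    have hφμ : ∀ n, MeasurePreserving (φ n) μ μ := fun n => (hφ n).2.2.2
    have hμK : μ (closure M)ᶜ = 0 :=
      measure_mono_null (compl_subset_compl.2 subset_closure)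
        (ae_restrict_mem hMopen.measurableSet)
    obtain ⟨π, h₁, h₂, hπ⟩ := exists_coupling_tendsto hMbdd.isCompact_closure hμK
      (Ultrafilter.of atTop) (fun n => measurePreserving_fst_graph (hφμ n))
      (fun n => measurePreserving_snd_graph (hφμ n))
    obtain ⟨κ, hκ, rfl⟩ := exists_isBistochastic_compProd_eq h₁ h₂
    refine ⟨κ, hκ, (hω.integrable le_top).ae_eq_of_forall_setIntegral_eq _ _
      (hκ.integrable_kernApply hω₀) fun A hA _ => ?_⟩
    have hg : Integrable (A.indicator fun _ => (1 : ℝ)) μ := (integrable_const 1).indicator hA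
    have hset : ∀ f : ℝ × ℝ → ℝ, ∫ x in A, f x ∂μ = ∫ x, A.indicator (fun _ => 1) x * f x ∂μ := by
      intro f
      rw [← integral_indicator hA]
      congr 1 with x
      by_cases hx : x ∈ A <;> simp [hx]
    rw [hset, hset, hκ.integral_mul_kernApply hg hω₀]
    refine tendsto_nhds_unique ((hlim _ hg).mono_left (Ultrafilter.of_le atTop)) ?_
    simpa only [integral_mul_graph (hφμ _) hg hω₀] using tendsto_integral_mul_of_coupling
      (fun n => measurePreserving_fst_graph (hφμ n))
      (fun n => measurePreserving_snd_graph (hφμ n)) h₁ h₂ hπ hg hω₀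
  · rintro ⟨κ, hκ, hωκ⟩
    have := hκ.1
    have h₁ : MeasurePreserving Prod.fst (μ ⊗ₘ κ) μ := measurePreserving_fst_compProd
    have h₂ := hκ.measurePreserving_snd
    choose φ hφ hclose using fun n : ℕ => exists_diffeo_coupling_le hMopen hMconn hMbdd
      h₁.map_eq h₂.map_eq (Nat.one_div_pos_of_nat (α := ℝ) (n := n))
    have hφμ : ∀ n, MeasurePreserving (φ n) μ μ := fun n => (hφ n).2.2.2
    refine ⟨φ, hφ, fun g hg => ?_⟩
    have hε := tendsto_one_div_add_atTop_nhds_zero_nat (𝕜 := ℝ)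
    have hgraph : ∀ n, Measurable fun x => (x, φ n x) := fun n =>
      measurable_id.prodMk (hφμ n).measurable
    have hweak := tendsto_integral_of_forall_le_thickening (ν := μ ⊗ₘ κ)
      (ρ := fun n => μ.map fun x => (x, φ n x)) (m := volume M)
      (δ := fun n : ℕ => ENNReal.ofReal (1 / ((n : ℝ) + 1))) hM0 hMfin
      (by rw [Measure.compProd_apply_univ, hμ, Measure.restrict_apply_univ])
      (fun n => by rw [Measure.map_apply (hgraph n) MeasurableSet.univ, preimage_univ, hμ,
        Measure.restrict_apply_univ]) hε
      (by simpa only [ENNReal.ofReal_zero] using ENNReal.tendsto_ofReal hε) (fun n A => by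
        rw [Measure.map_apply (hgraph n) Metric.isOpen_thickening.measurableSet]
        exact hclose n A)
    have hωeq : ∫ x, g x * ω x ∂μ = ∫ z, g z.1 * ω₀ z.2 ∂(μ ⊗ₘ κ) := by
      rw [← hκ.integral_mul_kernApply hg hω₀]
      refine integral_congr_ae ?_
      filter_upwards [hωκ] with x hx
      rw [hx]
    rw [hωeq]
    simpa only [integral_mul_graph (hφμ _) hg hω₀] using tendsto_integral_mul_of_coupling
      (fun n => measurePreserving_fst_graph (hφμ n))
      (fun n => measurePreserving_snd_graph (hφμ n)) h₁ h₂ hweak hg hω₀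
end

section
/- Let M ⊂ ℝ² be a bounded open connected set with smooth boundary, equipped with Lebesgue measure λ. Let ω₂ ∈ L^∞(M), let K be a bistochastic kernel on M, and set ω₁ := Kω₂. Then there exists a bistochastic kernel K̃ on M with ω₂ = K̃ω₁ almost everywhere if and only if for every strictly convex continuous function f : ℝ → ℝ one has ∫_M f(ω₁) dλ = ∫_M f(ω₂) dλ. -/
open MeasureTheory ProbabilityTheory

lemma MeasureTheory.MemLp.exists_ae_norm_le {X E : Type*} [MeasurableSpace X]
    [NormedAddCommGroup E] {μ : Measure X} {g : X → E} (hg : MemLp g ⊤ μ) :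
    ∃ C : ℝ, ∀ᵐ x ∂μ, ‖g x‖ ≤ C := by
  refine ⟨(eLpNormEssSup g μ).toReal, ?_⟩
  have h : eLpNormEssSup g μ ≠ ⊤ := by simpa using hg.eLpNorm_ne_top
  filter_upwards [enorm_ae_le_eLpNormEssSup g μ] with x hx
  simpa using ENNReal.toReal_mono h hx

namespace IsBistochastic

variable {X : Type*} [MeasurableSpace X] {μ : Measure X} {κ : Kernel X X} {ω : X → ℝ}

lemma comp_eq_s6 (hκ : IsBistochastic μ κ) : κ ∘ₘ μ = μ := by
  ext A hA
  rw [Measure.bind_apply hA κ.measurable.aemeasurable, hκ.2 A hA]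

lemma of_comp_eq [IsMarkovKernel κ] (h : κ ∘ₘ μ = μ) : IsBistochastic μ κ := by
  refine ⟨inferInstance, fun A hA ↦ ?_⟩
  rw [← Measure.bind_apply hA κ.measurable.aemeasurable, h]

lemma ae_ae (hκ : IsBistochastic μ κ) {p : X → Prop} (h : ∀ᵐ y ∂μ, p y) :
    ∀ᵐ x ∂μ, ∀ᵐ y ∂κ x, p y :=
  Measure.ae_ae_of_ae_comp (hκ.comp_eq_s6.symm ▸ h)

lemma ae_integrable (hκ : IsBistochastic μ κ) (hω : Integrable ω μ) :
    ∀ᵐ x ∂μ, Integrable ω (κ x) :=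
  Measure.ae_integrable_of_integrable_comp (hκ.comp_eq_s6.symm ▸ hω)

lemma integrable_kernApply_s6 (hκ : IsBistochastic μ κ) (hω : Integrable ω μ) :
    Integrable (kernApply κ ω) μ := by
  rw [← hκ.comp_eq_s6, Measure.comp_eq_comp_const_apply] at hω
  exact hω.integral_comp

lemma integral_kernApply_s6 (hκ : IsBistochastic μ κ) (hω : Integrable ω μ) :
    ∫ x, kernApply κ ω x ∂μ = ∫ x, ω x ∂μ := by
  have h := hω
  rw [← hκ.comp_eq_s6, Measure.comp_eq_comp_const_apply] at h
  have h' := Kernel.integral_comp h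
  rw [← Measure.comp_eq_comp_const_apply, hκ.comp_eq_s6] at h'
  simpa [kernApply] using h'.symm

lemma memLp_top_kernApply [IsFiniteMeasure μ] (hκ : IsBistochastic μ κ) (hω : MemLp ω ⊤ μ) :
    MemLp (kernApply κ ω) ⊤ μ := by
  have := hκ.1
  obtain ⟨C, hC⟩ := hω.exists_ae_norm_le
  refine memLp_top_of_bound (hκ.integrable_kernApply_s6 (hω.integrable le_top)).1 C ?_
  filter_upwards [hκ.ae_ae hC] with x hx
  simpa [kernApply] using norm_integral_le_of_norm_le_const hx

end IsBistochastic

lemma Continuous.integrable_comp_of_memLp_top {X : Type*} [MeasurableSpace X] {μ : Measure X}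
    [IsFiniteMeasure μ] {ω : X → ℝ} {f : ℝ → ℝ} (hf : Continuous f) (hω : MemLp ω ⊤ μ) :
    Integrable (fun x ↦ f (ω x)) μ := by
  obtain ⟨R, hR⟩ := hω.exists_ae_norm_le
  obtain ⟨C, hC⟩ := (isCompact_closedBall (0 : ℝ) R).exists_bound_of_continuousOn hf.continuousOn
  refine .of_bound (hf.comp_aestronglyMeasurable hω.1) C ?_
  filter_upwards [hR] with x hx
  exact hC _ (by simpa using hx)

namespace IsBistochastic

variable {X : Type*} [MeasurableSpace X] {μ : Measure X} [IsFiniteMeasure μ] {κ : Kernel X X}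
  {ω : X → ℝ}

/-- Bistochastic kernels decrease convex Casimirs. -/
lemma integral_comp_kernApply_le (hκ : IsBistochastic μ κ) (hω : MemLp ω ⊤ μ) {f : ℝ → ℝ}
    (hf : Continuous f) (hconv : ConvexOn ℝ Set.univ f) :
    ∫ x, f (kernApply κ ω x) ∂μ ≤ ∫ x, f (ω x) ∂μ := by
  have := hκ.1
  have hfω := hf.integrable_comp_of_memLp_top hω
  rw [← hκ.integral_kernApply_s6 hfω]
  refine integral_mono_ae (hf.integrable_comp_of_memLp_top (hκ.memLp_top_kernApply hω))
    (hκ.integrable_kernApply_s6 hfω) ?_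
  filter_upwards [hκ.ae_integrable (hω.integrable le_top), hκ.ae_integrable hfω] with x h h'
  exact hconv.map_integral_le hf.continuousOn isClosed_univ (by simp) h h'

/-- If a bistochastic kernel preserves the second moment of `ω`, then `ω` is almost surely
constant along its transitions. -/
lemma ae_ae_eq_of_integral_sq_eq (hκ : IsBistochastic μ κ) (hω : MemLp ω ⊤ μ)
    (h : ∫ x, kernApply κ ω x ^ 2 ∂μ = ∫ x, ω x ^ 2 ∂μ) :
    ∀ᵐ x ∂μ, ∀ᵐ y ∂κ x, ω y = kernApply κ ω x := by
  have := hκ.1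
  have hsq : Continuous fun t : ℝ ↦ t ^ 2 := by fun_prop
  have hi := hω.integrable le_top
  have hi2 := hsq.integrable_comp_of_memLp_top hω
  have hk2 := hsq.integrable_comp_of_memLp_top (hκ.memLp_top_kernApply hω)
  have hvar : ∀ᵐ x ∂μ, Integrable (fun y ↦ (ω y - kernApply κ ω x) ^ 2) (κ x) ∧
      ∫ y, (ω y - kernApply κ ω x) ^ 2 ∂κ x
        = kernApply κ (fun y ↦ ω y ^ 2) x - kernApply κ ω x ^ 2 := by
    filter_upwards [hκ.ae_integrable hi, hκ.ae_integrable hi2] with x h1 h2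
    have hexp : (fun y ↦ (ω y - kernApply κ ω x) ^ 2)
        = fun y ↦ ω y ^ 2 - 2 * kernApply κ ω x * ω y + kernApply κ ω x ^ 2 := by
      ext y; ring
    have h3 := h1.const_mul (2 * kernApply κ ω x)
    rw [hexp]
    refine ⟨(h2.sub h3).add (integrable_const _), ?_⟩
    rw [integral_add (by exact h2.sub h3) (integrable_const _), integral_sub h2 h3, integral_const_mul]
    simp only [kernApply, integral_const, probReal_univ, one_smul]
    ring
  have hzero : (fun x ↦ kernApply κ (fun y ↦ ω y ^ 2) x - kernApply κ ω x ^ 2) =ᵐ[μ] 0 := by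
    rw [← integral_eq_zero_iff_of_nonneg_ae _ (by exact (hκ.integrable_kernApply_s6 hi2).sub hk2),
      integral_sub (hκ.integrable_kernApply_s6 hi2) hk2, hκ.integral_kernApply_s6 hi2, h, sub_self]
    filter_upwards [hvar] with x hx
    rw [← hx.2]
    exact integral_nonneg fun y ↦ sq_nonneg _
  filter_upwards [hvar, hzero] with x hx h0
  have h1 := hx.2.trans h0
  rw [Pi.zero_apply, integral_eq_zero_iff_of_nonneg (fun y ↦ sq_nonneg _) hx.1] at h1
  filter_upwards [h1] with y hy
  exact sub_eq_zero.1 (pow_eq_zero_iff two_ne_zero |>.1 hy)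

variable [StandardBorelSpace X] [Nonempty X]

lemma posterior (hκ : IsBistochastic μ κ) [IsMarkovKernel κ] : IsBistochastic μ (κ†μ) := by
  refine of_comp_eq ?_
  have h := posterior_comp_self (κ := κ) (μ := μ)
  rwa [hκ.comp_eq_s6] at h

/-- Relations that hold almost surely along `κ` hold almost surely, reversed, along its
posterior. -/
lemma ae_ae_posterior (hκ : IsBistochastic μ κ) [IsMarkovKernel κ] {p : X × X → Prop}
    (hp : MeasurableSet {z | p z}) (h : ∀ᵐ x ∂μ, ∀ᵐ y ∂κ x, p (x, y)) :
    ∀ᵐ y ∂μ, ∀ᵐ x ∂(κ†μ) y, p (x, y) := by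
  have h' : ∀ᵐ z ∂(μ ⊗ₘ κ).map Prod.swap, p z.swap := by
    refine (ae_map_iff measurable_swap.aemeasurable (measurable_swap hp)).2 ?_
    simpa using (Measure.ae_compProd_iff hp).2 h
  rw [← compProd_posterior_eq_map_swap, hκ.comp_eq_s6] at h'
  exact Measure.ae_ae_of_ae_compProd h'

lemma ae_eq_kernApply_posterior (hκ : IsBistochastic μ κ) [IsMarkovKernel κ] {ω' : X → ℝ}
    (hω : AEMeasurable ω μ) (hω' : AEMeasurable ω' μ)
    (h : ∀ᵐ x ∂μ, ∀ᵐ y ∂κ x, ω y = ω' x) : ω =ᵐ[μ] kernApply (κ†μ) ω' := by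
  have hmk : ∀ᵐ x ∂μ, ∀ᵐ y ∂κ x, hω.mk ω y = hω'.mk ω' x := by
    filter_upwards [h, hκ.ae_ae hω.ae_eq_mk, hω'.ae_eq_mk] with x h1 h2 h3
    filter_upwards [h1, h2] with y h4 h5
    rw [← h5, h4, h3]
  filter_upwards [hκ.ae_ae_posterior (p := fun z ↦ hω.mk ω z.2 = hω'.mk ω' z.1)
    (measurableSet_eq_fun (hω.measurable_mk.comp measurable_snd)
      (hω'.measurable_mk.comp measurable_fst)) hmk,
    hκ.posterior.ae_ae hω'.ae_eq_mk, hω.ae_eq_mk] with y h1 h2 h3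
  have h4 : ω' =ᵐ[(κ†μ) y] fun _ ↦ ω y := by
    filter_upwards [h1, h2] with x h5 h6
    rw [h6, ← h5, h3]
  simp [kernApply, integral_congr_ae h4]

end IsBistochastic

/-- with `ω₁ = Kω₂`, one can go back (`ω₂ = K̃ω₁` for some
bistochastic `K̃`) iff all strictly convex Casimirs of `ω₁` and `ω₂` agree. -/
theorem mixing_reversible_iff_casimirs
    (M : Set (ℝ × ℝ)) (hMopen : IsOpen M) (hMconn : IsConnected M)
    (hMbdd : Bornology.IsBounded M) (hMsm : HasSmoothBoundary M)
    (ω₂ : ℝ × ℝ → ℝ) (hω₂ : MemLp ω₂ ⊤ (volume.restrict M))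
    (κ : Kernel (ℝ × ℝ) (ℝ × ℝ)) (hκ : IsBistochastic (volume.restrict M) κ)
    (ω₁ : ℝ × ℝ → ℝ) (hω₁ : ω₁ = kernApply κ ω₂) :
    (∃ κ' : Kernel (ℝ × ℝ) (ℝ × ℝ), IsBistochastic (volume.restrict M) κ' ∧
        ω₂ =ᵐ[volume.restrict M] kernApply κ' ω₁) ↔
    (∀ f : ℝ → ℝ, Continuous f → StrictConvexOn ℝ Set.univ f →
      ∫ x, f (ω₁ x) ∂(volume.restrict M) = ∫ x, f (ω₂ x) ∂(volume.restrict M)) := by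
  have : IsFiniteMeasure (volume.restrict M) := ⟨by simpa using hMbdd.measure_lt_top⟩
  have := hκ.1
  subst hω₁
  have hω₁ := hκ.memLp_top_kernApply hω₂
  constructor
  · rintro ⟨κ', hκ', h⟩ f hf hconv
    refine le_antisymm (hκ.integral_comp_kernApply_le hω₂ hf hconv.convexOn) ?_
    exact (integral_congr_ae (h.fun_comp f)).trans_le
      (hκ'.integral_comp_kernApply_le hω₁ hf hconv.convexOn)
  · intro h
    refine ⟨κ†(volume.restrict M), hκ.posterior, ?_⟩
    exact hκ.ae_eq_kernApply_posterior hω₂.1.aemeasurable hω₁.1.aemeasurable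
      (hκ.ae_ae_eq_of_integral_sq_eq hω₂
        (h _ (by fun_prop) (Even.strictConvexOn_pow even_two (by norm_num))))
end

section
/- Let M be a bounded open subset of ℝ² with finite Lebesgue measure λ, let K be a bistochastic kernel on M, let ω ∈ L^∞(M), and let f : ℝ → ℝ be convex and continuous. Then ∫_M f((Kω)(x)) dλ(x) ≤ ∫_M f(ω(x)) dλ(x). -/
open MeasureTheory ProbabilityTheory

/-- A continuous function of an essentially bounded real function is essentially bounded. -/
lemma Continuous.memLp_top_comp {X : Type*} [MeasurableSpace X] {μ : Measure X} {f : ℝ → ℝ}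
    (hf : Continuous f) {g : X → ℝ} (hg : MemLp g ⊤ μ) : MemLp (fun x => f (g x)) ⊤ μ := by
  obtain ⟨B, hB⟩ := (isCompact_closedBall (0 : ℝ)
    (lpNorm g ⊤ μ)).exists_bound_of_continuousOn hf.continuousOn
  refine memLp_top_of_bound (hf.comp_aestronglyMeasurable hg.1) B ?_
  filter_upwards [ae_le_lpNorm_exponent_top hg] with x hx
  exact hB _ (by simpa using hx)

/-- The Markov operator of a kernel preserving `μ` maps integrable functions to integrable
functions. -/
lemma ProbabilityTheory.Kernel.Invariant.integrable_integral {X : Type*} [MeasurableSpace X]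
    {μ : Measure X} {κ : Kernel X X} (h : κ.Invariant μ) {g : X → ℝ} (hg : Integrable g μ) :
    Integrable (fun x => ∫ y, g y ∂(κ x)) μ := by
  have hg' : Integrable g ((κ ∘ₖ Kernel.const Unit μ) ()) := by
    rwa [← Measure.comp_eq_comp_const_apply, h.def]
  simpa using hg'.integral_comp

/-- The Markov operator of a kernel preserving `μ` preserves the `μ`-integral. -/
lemma ProbabilityTheory.Kernel.Invariant.integral_integral {X : Type*} [MeasurableSpace X]
    {μ : Measure X} {κ : Kernel X X} (h : κ.Invariant μ) {g : X → ℝ} (hg : Integrable g μ) :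
    ∫ x, ∫ y, g y ∂(κ x) ∂μ = ∫ x, g x ∂μ := by
  have hg' : Integrable g ((κ ∘ₖ Kernel.const Unit μ) ()) := by
    rwa [← Measure.comp_eq_comp_const_apply, h.def]
  have := Kernel.integral_comp hg'
  rw [← Measure.comp_eq_comp_const_apply, h.def] at this
  simpa using this.symm

lemma IsBistochastic.invariant {X : Type*} [MeasurableSpace X] {μ : Measure X}
    {κ : Kernel X X} (h : IsBistochastic μ κ) : κ.Invariant μ := by
  ext A hA
  rw [Measure.bind_apply hA κ.aemeasurable, h.2 A hA]

/-- A bistochastic operator preserves essential boundedness. -/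
lemma IsBistochastic.memLp_top_kernApply_s7 {X : Type*} [MeasurableSpace X] {μ : Measure X}
    [IsFiniteMeasure μ] {κ : Kernel X X} (h : IsBistochastic μ κ) {g : X → ℝ}
    (hg : MemLp g ⊤ μ) : MemLp (kernApply κ g) ⊤ μ := by
  have := h.1
  have hbound : ∀ᵐ y ∂(μ.bind κ), ‖g y‖ ≤ lpNorm g ⊤ μ := by
    rw [h.invariant.def]
    exact ae_le_lpNorm_exponent_top hg
  refine memLp_top_of_bound
    (h.invariant.integrable_integral (hg.integrable le_top)).aestronglyMeasurable
    (lpNorm g ⊤ μ) ?_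
  filter_upwards [Measure.ae_ae_of_ae_comp hbound] with x hx
  simpa [kernApply] using norm_integral_le_of_norm_le_const hx

/-- Integral Jensen inequality for bistochastic operators on a finite measure space. -/
lemma IsBistochastic.integral_comp_kernApply_le_s7 {X : Type*} [MeasurableSpace X] {μ : Measure X}
    [IsFiniteMeasure μ] {κ : Kernel X X} (h : IsBistochastic μ κ) {g : X → ℝ}
    (hg : MemLp g ⊤ μ) {f : ℝ → ℝ} (hfc : Continuous f) (hf : ConvexOn ℝ Set.univ f) :
    ∫ x, f (kernApply κ g x) ∂μ ≤ ∫ x, f (g x) ∂μ := by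
  have := h.1
  have hgi : Integrable g μ := hg.integrable le_top
  have hfgi : Integrable (fun x => f (g x)) μ := (hfc.memLp_top_comp hg).integrable le_top
  rw [← h.invariant.integral_integral hfgi]
  refine integral_mono_ae
    ((hfc.memLp_top_comp (h.memLp_top_kernApply_s7 hg)).integrable le_top)
    (h.invariant.integrable_integral hfgi) ?_
  rw [← h.invariant.def] at hgi hfgi
  filter_upwards [Measure.ae_integrable_of_integrable_comp hgi,
    Measure.ae_integrable_of_integrable_comp hfgi] with x hx hfx
  exact hf.map_integral_le hfc.continuousOn isClosed_univ (by simp) hx hfx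

/-- convex Casimirs do not increase under bistochastic operators. -/
theorem convex_casimir_decreases
    (M : Set (ℝ × ℝ)) (hMopen : IsOpen M) (hMbdd : Bornology.IsBounded M)
    (κ : Kernel (ℝ × ℝ) (ℝ × ℝ)) (hκ : IsBistochastic (volume.restrict M) κ)
    (ω : ℝ × ℝ → ℝ) (hω : MemLp ω ⊤ (volume.restrict M))
    (f : ℝ → ℝ) (hfc : Continuous f) (hfconv : ConvexOn ℝ Set.univ f) :
    ∫ x, f (kernApply κ ω x) ∂(volume.restrict M)
      ≤ ∫ x, f (ω x) ∂(volume.restrict M) := by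
  have : IsFiniteMeasure (volume.restrict M) :=
    isFiniteMeasure_restrict.2 hMbdd.measure_lt_top.ne
  exact hκ.integral_comp_kernApply_le_s7 hω hfc hfconv
end
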